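/- arXiv:1806.08849 — 3 statements merged into one kernel-verified Lean document; each statement's English description precedes it below -/
import Mathlib

section
/- For every positive integer k, the pair (k, 1) is findable; that is, for every δ > 0 there exists p₀ such that for every prime p ≥ p₀, every red–blue colouring of ℤ/pℤ in which each colour class has at least δ·p elements contains an arithmetic progression x, x+d, …, x+kd with d ≠ 0 whose first k terms are red and whose last term is blue. -/
/-- A colouring of `ZMod p` (red set `A`, blue its complement) contains an `(a,b)`-AP:
an arithmetic progression with nonzero common difference whose first `a` terms are red
and whose last `b` terms are blue. -/
def HasAP {p : ℕ} (A : Set (ZMod p)) (a b : ℕ) : Prop :=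
  ∃ x d : ZMod p, d ≠ 0 ∧
    (∀ i : ℕ, i < a → x + (i : ZMod p) * d ∈ A) ∧
    (∀ i : ℕ, a ≤ i → i < a + b → x + (i : ZMod p) * d ∉ A)

/-- The pair `(a, b)` is findable: for every `δ > 0` there exists `p₀` such that for every
prime `p ≥ p₀`, every red–blue colouring of `ZMod p` in which each colour class has at
least `δ·p` elements contains an `(a,b)`-AP. -/
def Findable (a b : ℕ) : Prop :=
  ∀ δ : ℝ, 0 < δ → ∃ p₀ : ℕ, ∀ p : ℕ, p.Prime → p₀ ≤ p →
    ∀ A : Set (ZMod p),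
      δ * p ≤ Nat.card ↥A → δ * p ≤ Nat.card ↥(Aᶜ) → HasAP A a b

namespace Szem

open Combinatorics

/-- The average of a real function over a finite type. -/
noncomputable def av {X : Type*} (f : X → ℝ) : ℝ := (∑ᶠ x, f x) / Nat.card X

open Classical in
/-- The indicator function of a set. -/
noncomputable def ind {X : Type*} (A : Set X) (x : X) : ℝ := if x ∈ A then 1 else 0

/-- The density of a subset of a finite type. -/
noncomputable def dens {X : Type*} (A : Set X) : ℝ := av (ind A)

section averages
variable {X Y C : Type*}

lemma av_eq [Fintype X] (f : X → ℝ) : av f = (∑ x, f x) / Fintype.card X := by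
  rw [av, finsum_eq_sum_of_fintype, Nat.card_eq_fintype_card]

lemma ind_of_mem {A : Set X} {x : X} (h : x ∈ A) : ind A x = 1 := by simp [ind, h]
lemma ind_of_not_mem {A : Set X} {x : X} (h : x ∉ A) : ind A x = 0 := by simp [ind, h]
lemma ind_nonneg (A : Set X) (x : X) : 0 ≤ ind A x := by unfold ind; split_ifs <;> norm_num
lemma ind_le_one (A : Set X) (x : X) : ind A x ≤ 1 := by unfold ind; split_ifs <;> norm_num

lemma ind_congr {A : Set X} {B : Set Y} {x : X} {y : Y} (h : x ∈ A ↔ y ∈ B) :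
    ind A x = ind B y := by
  by_cases hx : x ∈ A
  · rw [ind_of_mem hx, ind_of_mem (h.1 hx)]
  · rw [ind_of_not_mem hx, ind_of_not_mem (fun hy => hx (h.2 hy))]

lemma av_mono [Finite X] {f g : X → ℝ} (h : ∀ x, f x ≤ g x) : av f ≤ av g := by
  cases nonempty_fintype X
  rw [av_eq, av_eq]
  gcongr with x
  exact h x

lemma av_add [Finite X] (f g : X → ℝ) : av (fun x => f x + g x) = av f + av g := by
  cases nonempty_fintype X
  rw [av_eq, av_eq, av_eq, Finset.sum_add_distrib, add_div]

lemma av_sub [Finite X] (f g : X → ℝ) : av (fun x => f x - g x) = av f - av g := by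
  cases nonempty_fintype X
  rw [av_eq, av_eq, av_eq, Finset.sum_sub_distrib, sub_div]

lemma av_mul [Finite X] (c : ℝ) (f : X → ℝ) : av (fun x => c * f x) = c * av f := by
  cases nonempty_fintype X
  rw [av_eq, av_eq, ← Finset.mul_sum, mul_div_assoc]

lemma av_const [Finite X] [Nonempty X] (c : ℝ) : av (fun _ : X => c) = c := by
  cases nonempty_fintype X
  rw [av_eq]
  have : (Fintype.card X : ℝ) ≠ 0 := by simp
  simp
  

lemma av_comm [Finite X] [Finite Y] (f : X → Y → ℝ) :
    av (fun x => av (fun y => f x y)) = av (fun y => av (fun x => f x y)) := by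
  cases nonempty_fintype X
  cases nonempty_fintype Y
  simp only [av_eq, ← Finset.sum_div]
  rw [Finset.sum_comm, div_right_comm]

lemma av_equiv (e : X ≃ Y) (f : Y → ℝ) : av (fun x => f (e x)) = av f := by
  rw [av, av, Nat.card_congr e, finsum_comp_equiv e]

lemma av_prod [Finite X] [Finite Y] (f : X × Y → ℝ) :
    av f = av (fun x => av (fun y => f (x, y))) := by
  cases nonempty_fintype X
  cases nonempty_fintype Y
  simp only [av_eq, ← Finset.sum_div]
  rw [Fintype.sum_prod_type, Fintype.card_prod, div_div]
  push_cast
  rw [mul_comm]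

lemma av_sumType {I J β : Type*} [Finite I] [Finite J] [Finite β] (f : (I ⊕ J → β) → ℝ) :
    av f = av (fun x => av (fun y => f (Sum.elim x y))) := by
  rw [← av_equiv (Equiv.sumArrowEquivProdArrow I J β).symm f, av_prod]
  rfl

lemma exists_ge_of_av [Finite X] [Nonempty X] {f : X → ℝ} {c : ℝ} (h : c ≤ av f) :
    ∃ x, c ≤ f x := by
  by_contra! H
  cases nonempty_fintype X
  have h0 : (0 : ℝ) < Fintype.card X := by exact_mod_cast Fintype.card_pos
  rw [av_eq, le_div_iff₀ h0] at h
  have : ∑ x, f x < ∑ _x : X, c :=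
    Finset.sum_lt_sum_of_nonempty Finset.univ_nonempty (fun x _ => H x)
  simp at this
  linarith

lemma dens_nonneg [Finite X] (A : Set X) : 0 ≤ dens A := by
  cases nonempty_fintype X
  rw [dens, av_eq]
  exact div_nonneg (Finset.sum_nonneg fun x _ => ind_nonneg A x) (by positivity)

lemma dens_le_one [Finite X] [Nonempty X] (A : Set X) : dens A ≤ 1 := by
  calc dens A ≤ av (fun _ : X => (1 : ℝ)) := av_mono (ind_le_one A)
    _ = 1 := av_const 1

lemma dens_mono [Finite X] {A B : Set X} (h : A ⊆ B) : dens A ≤ dens B := by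
  refine av_mono fun x => ?_
  by_cases hx : x ∈ A
  · rw [ind_of_mem hx, ind_of_mem (h hx)]
  · rw [ind_of_not_mem hx]; exact ind_nonneg _ _

lemma nonempty_of_dens_pos [Finite X] {A : Set X} (h : 0 < dens A) : A.Nonempty := by
  by_contra H
  rw [Set.not_nonempty_iff_eq_empty] at H
  subst H
  have : dens (∅ : Set X) = 0 := by
    cases nonempty_fintype X
    rw [dens, av_eq]
    simp [ind]
  linarith

/-- Markov. -/
lemma markov [Finite X] [Nonempty X] {g : X → ℝ} {ε : ℝ} (hg : ∀ x, g x ≤ 1) (hε : 0 ≤ ε)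
    (h : 2 * ε ≤ av g) : ε ≤ dens {x | ε ≤ g x} := by
  have : av g ≤ av (fun x => ind {x | ε ≤ g x} x + ε) := by
    refine av_mono fun x => ?_
    by_cases hx : x ∈ {x | ε ≤ g x}
    · rw [ind_of_mem hx]; linarith [hg x]
    · rw [ind_of_not_mem hx]
      simp at hx
      linarith
  rw [av_add, av_const] at this
  change av g ≤ dens _ + ε at this
  linarith

lemma pigeon [Finite X] [Finite C] {R : C → Set X} {S : Set X} {ε : ℝ} (hε : 0 < ε)
    (hS : ε ≤ dens S) (h : ∀ x ∈ S, ∃ c, x ∈ R c) : ∃ c, ε / (Nat.card C + 1) ≤ dens (R c) := by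
  by_contra! H
  cases nonempty_fintype X
  cases nonempty_fintype C
  have h1 : dens S ≤ ∑ c, dens (R c) := by
    simp only [dens, av_eq, ← Finset.sum_div]
    rw [Finset.sum_comm]
    gcongr with x
    by_cases hx : x ∈ S
    · obtain ⟨c, hc⟩ := h x hx
      rw [ind_of_mem hx, ← ind_of_mem hc]
      exact Finset.single_le_sum (f := fun c => ind (R c) x)
        (fun c _ => ind_nonneg (R c) x) (Finset.mem_univ c)
    · rw [ind_of_not_mem hx]
      exact Finset.sum_nonneg (fun c _ => ind_nonneg (R c) x)
  have h2 : ∑ c, dens (R c) ≤ ∑ _c : C, ε / (Nat.card C + 1) :=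
    Finset.sum_le_sum fun c _ => (H c).le
  simp at h2
  have h3 : (Fintype.card C : ℝ) * (ε / (Fintype.card C + 1)) < ε := by
    rw [← mul_div_assoc, div_lt_iff₀ (by positivity)]
    nlinarith
  linarith

/-- The combination of Markov's inequality with the pigeonhole principle. -/
lemma popular [Finite X] [Nonempty X] [Finite Y] [Nonempty Y] [Finite C] (A : X → Y → Prop)
    (R : C → Set X → Prop) {ε : ℝ} (hε : 0 < ε)
    (hA : 2 * ε ≤ av (fun y => dens {x | A x y}))
    (hR : ∀ y, ε ≤ dens {x | A x y} → ∃ c, R c {x | A x y}) :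
    ∃ c, ε / (Nat.card C + 1) ≤ dens {y | R c {x | A x y}} := by
  have h1 := markov (fun y => dens_le_one {x | A x y}) hε.le hA
  exact pigeon hε h1 fun y hy => hR y hy

end averages

section words
variable {η ζ β ι I J : Type*}

/-- Composition of combinatorial subspaces. -/
def compS (V : Subspace ζ β ι) (W : Subspace η β ζ) : Subspace η β ι where
  idxFun i := (V.idxFun i).elim Sum.inl W.idxFun
  proper e := by
    obtain ⟨z, hz⟩ := W.proper e
    obtain ⟨i, hi⟩ := V.proper z
    exact ⟨i, by simp [hi, hz]⟩

lemma compS_apply (V : Subspace ζ β ι) (W : Subspace η β ζ) (v : η → β) :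
    compS V W v = V (W v) := by
  ext i
  rw [Subspace.apply_def, Subspace.apply_def]
  cases h : V.idxFun i <;> simp [compS, h, Subspace.apply_def]

/-- A line inside a subspace. -/
def compL (V : Subspace ζ β ι) (l : Line β ζ) : Line β ι where
  idxFun i := (V.idxFun i).elim some l.idxFun
  proper := by
    obtain ⟨z, hz⟩ := l.proper
    obtain ⟨i, hi⟩ := V.proper z
    exact ⟨i, by simp [hi, hz]⟩

lemma compL_apply (V : Subspace ζ β ι) (l : Line β ζ) (b : β) : compL V l b = V (l b) := by
  ext i
  rw [Line.coe_apply, Subspace.apply_def]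
  cases h : V.idxFun i <;> simp [compL, h]

/-- Relabelling of coordinates. -/
def ofEquiv (β : Type*) (e : η ≃ ι) : Subspace η β ι where
  idxFun i := Sum.inr (e.symm i)
  proper z := ⟨e z, by simp⟩

lemma ofEquiv_apply (e : η ≃ ι) (v : η → β) : ofEquiv β e v = fun i => v (e.symm i) := by
  ext i; simp [ofEquiv, Subspace.apply_def]

/-- Fixing the first group of coordinates. -/
def pre (x : I → β) : Subspace J β (I ⊕ J) where
  idxFun := Sum.elim (fun i => Sum.inl (x i)) Sum.inr
  proper e := ⟨Sum.inr e, rfl⟩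

lemma pre_apply (x : I → β) (y : J → β) : pre x y = Sum.elim x y := by
  ext i; cases i <;> simp [pre, Subspace.apply_def]

/-- Fixing the second group of coordinates. -/
def suf (y : J → β) : Subspace I β (I ⊕ J) where
  idxFun := Sum.elim Sum.inr (fun i => Sum.inl (y i))
  proper e := ⟨Sum.inl e, rfl⟩

lemma suf_apply (y : J → β) (x : I → β) : suf y x = Sum.elim x y := by
  ext i; cases i <;> simp [suf, Subspace.apply_def]

lemma subspace_injective (V : Subspace η β ι) : Function.Injective (fun v : η → β => V v) := by
  intro v w h
  ext e
  obtain ⟨i, hi⟩ := V.proper e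
  have := congrFun h i
  simpa [Subspace.apply_def, hi] using this

instance [Finite η] [Finite β] [Finite ι] : Finite (Subspace η β ι) :=
  Finite.of_injective (fun V => V.idxFun) fun _ _ h => Subspace.ext h

instance [Finite β] [Finite ι] : Finite (Line β ι) :=
  Finite.of_injective (fun V => V.idxFun) fun V W h => by
    rcases V with ⟨f, hf⟩
    rcases W with ⟨g, hg⟩
    simp at h
    simp [h]

/-- The product of a line and a subspace. -/
def lineProd (l : Line β I) (V : Subspace η β J) : Subspace (Option η) β (I ⊕ J) where
  idxFun := Sum.elim (fun i => (l.idxFun i).elim (Sum.inr none) Sum.inl)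
    (fun j => (V.idxFun j).elim Sum.inl (fun e => Sum.inr (some e)))
  proper e := by
    cases e with
    | none => obtain ⟨i, hi⟩ := l.proper; exact ⟨Sum.inl i, by simp [hi]⟩
    | some e => obtain ⟨i, hi⟩ := V.proper e; exact ⟨Sum.inr i, by simp [hi]⟩

lemma lineProd_apply (l : Line β I) (V : Subspace η β J) (v : Option η → β) :
    lineProd l V v = Sum.elim (l (v none)) (V (fun e => v (some e))) := by
  ext i
  rcases i with i | i
  · cases h : l.idxFun i <;> simp [lineProd, Subspace.apply_def, h]
  · cases h : V.idxFun i <;> simp [lineProd, Subspace.apply_def, h]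

lemma exists_split (X : Type) [Finite X] (ι : Type) [Finite ι] (N : ℕ)
    (h : Nat.card X + N ≤ Nat.card ι) :
    ∃ m, N ≤ m ∧ Nonempty ((X ⊕ Fin m) ≃ ι) := by
  refine ⟨Nat.card ι - Nat.card X, by omega, Finite.card_eq.1 ?_⟩
  rw [Nat.card_sum, Nat.card_fin]; omega

/-- Pull back an average along a relabelling. -/
lemma av_relabel [Finite η] [Finite ι] [Finite β] (e : η ≃ ι) (f : (ι → β) → ℝ) :
    av (fun v => f (ofEquiv β e v)) = av f := by
  simp only [ofEquiv_apply]
  exact av_equiv (Equiv.arrowCongr e (Equiv.refl β)) f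

end words
/-- `δ` is a density forcing combinatorial lines over the alphabet `β`. -/
def Good (β : Type) (δ : ℝ) : Prop :=
  ∃ N : ℕ, ∀ (ι : Type) [Finite ι], N ≤ Nat.card ι → ∀ A : Set (ι → β), δ ≤ dens A →
    ∃ l : Line β ι, ∀ b, l b ∈ A

/-- The density Hales-Jewett property for the alphabet `β`. -/
def DHJ (β : Type) : Prop := ∀ δ : ℝ, 0 < δ → Good β δ

lemma mdhj {α : Type} [Finite α] [Nonempty α] (h : DHJ α) (d : ℕ) : ∀ δ : ℝ, 0 < δ →
    ∃ N : ℕ, ∀ (ι : Type) [Finite ι], N ≤ Nat.card ι → ∀ A : Set (ι → α), δ ≤ dens A →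
      ∃ V : Subspace (Fin d) α ι, ∀ v, V v ∈ A := by
  induction d with
  | zero =>
    intro δ hδ
    refine ⟨0, fun ι _ _ A hA => ?_⟩
    obtain ⟨x, hx⟩ := nonempty_of_dens_pos (hδ.trans_le hA)
    exact ⟨⟨fun i => Sum.inl (x i), fun e => e.elim0⟩, fun v => hx⟩
  | succ d ih =>
    intro δ hδ
    obtain ⟨n, hn⟩ := h (δ / 2) (by positivity)
    obtain ⟨N, hN⟩ := ih (δ / 2 / (Nat.card (Line α (Fin n)) + 1)) (by positivity)
    refine ⟨n + N, fun ι _ hι A hA => ?_⟩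
    obtain ⟨m, hm, ⟨e⟩⟩ := exists_split (Fin n) ι N (by simpa using hι)
    have h1 : 2 * (δ / 2) ≤ av (fun y : Fin m → α =>
        dens {x : Fin n → α | ofEquiv α e (Sum.elim x y) ∈ A}) := by
      have : dens A = av (fun y : Fin m → α =>
        dens {x : Fin n → α | ofEquiv α e (Sum.elim x y) ∈ A}) := by
        unfold dens
        rw [← av_relabel e, av_sumType, av_comm]
        rfl
      linarith
    obtain ⟨l, hl⟩ := popular (fun (x : Fin n → α) (y : Fin m → α) =>
      ofEquiv α e (Sum.elim x y) ∈ A) (fun (l : Line α (Fin n)) B => ∀ b, l b ∈ B)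
      (by positivity) h1 (fun y hB => hn (Fin n) (by simp) _ hB)
    obtain ⟨V, hV⟩ := hN (Fin m) (by simpa using hm) _ hl
    refine ⟨compS (ofEquiv α e) (compS (lineProd l V) (ofEquiv α (finSuccEquiv d))), fun v => ?_⟩
    rw [compS_apply, compS_apply, lineProd_apply]
    exact hV _ _

section cover
variable {α : Type}

/-- Insensitivity to exchanging the letters `none` and `some a`. -/
def Insens {ι : Type} (a : α) (D : Set (ι → Option α)) : Prop :=
  ∀ x y : ι → Option α, (∀ i, (x i).getD a = (y i).getD a) → x ∈ D → y ∈ D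

lemma Insens.compl {ι : Type} {a : α} {D : Set (ι → Option α)} (h : Insens a D) : Insens a Dᶜ :=
  fun x y hxy hx hy => hx (h y x (fun i => (hxy i).symm) hy)

lemma Insens.comp {ι ζ : Type} {a : α} {D : Set (ι → Option α)} (h : Insens a D)
    (V : Subspace ζ (Option α) ι) : Insens a {v | V v ∈ D} := by
  intro x y hxy hx
  refine h _ _ (fun i => ?_) hx
  cases hi : V.idxFun i
  · simp [Subspace.apply_def, hi]
  · simp [Subspace.apply_def, hi, hxy]

/-- Extend a word on `J` by `none`. -/
noncomputable def ext {n : ℕ} (J : Finset (Fin n)) (z : J → α) (i : Fin n) : Option α :=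
  if h : i ∈ J then some (z ⟨i, h⟩) else none

lemma sum_ext [Fintype α] {n : ℕ} (g : (Fin n → Option α) → ℝ) :
    ∑ x, g x = ∑ J : Finset (Fin n), ∑ z : J → α, g (ext J z) := by
  classical
  rw [← Finset.sum_fiberwise (s := Finset.univ)
    (g := fun x : Fin n → Option α => Finset.univ.filter fun i => (x i).isSome)]
  refine Finset.sum_congr rfl fun J _ => ?_
  symm
  refine Finset.sum_bij (fun z _ => ext J z) ?_ ?_ ?_ ?_
  · intro z _
    simp only [Finset.mem_filter, Finset.mem_univ, true_and]
    ext i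
    by_cases h : i ∈ J <;> simp [ext, h]
  · intro z _ w _ hzw
    ext i
    have := congrFun hzw i
    simpa [ext] using this
  · intro x hx
    simp only [Finset.mem_filter, Finset.mem_univ, true_and] at hx
    have hx' : ∀ i, i ∈ J ↔ (x i).isSome := by
      intro i; rw [← hx]; simp
    refine ⟨fun i => (x i).get ((hx' i).1 i.2), Finset.mem_univ _, ?_⟩
    funext i
    by_cases h : i ∈ J
    · simp [ext, h]
    · have := (hx' i).not.1 h
      simp at this
      simp [ext, h, this]
  · intros; rfl

lemma few [Finite α] [Nonempty α] (N : ℕ) (ε : ℝ) (hε : 0 < ε) : ∃ n : ℕ,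
    dens {x : Fin n → Option α | (Finset.univ.filter fun i => (x i).isSome).card < N} < ε := by
  classical
  cases nonempty_fintype α
  let w : Option α → ℝ := fun o => if o.isSome then 1 / 2 else 1
  let r : ℝ := av w
  have hr0 : 0 ≤ r := by
    have : av (fun _ : Option α => (0 : ℝ)) ≤ av w := av_mono fun x => by
      simp only [w]; split_ifs <;> norm_num
    rwa [av_const] at this
  have hr1 : r < 1 := by
    have hc : (0 : ℝ) < Fintype.card α := by exact_mod_cast Fintype.card_pos
    simp only [r, av_eq, Fintype.sum_option, w, Fintype.card_option]
    simp
    rw [div_lt_one (by positivity)]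
    linarith
  obtain ⟨n, hn⟩ := exists_pow_lt_of_lt_one (show 0 < ε / 2 ^ N by positivity) hr1
  refine ⟨n, ?_⟩
  have h1 : av (fun x : Fin n → Option α => ∏ i, w (x i)) = r ^ n := by
    simp only [r, av_eq, div_pow]
    congr 1
    · have := Finset.prod_univ_sum (fun _ : Fin n => (Finset.univ : Finset (Option α)))
        (fun _ o => w o)
      simp only [Fintype.piFinset_univ] at this
      rw [← this]; simp
    · simp
  have h2 : dens {x : Fin n → Option α | (Finset.univ.filter fun i => (x i).isSome).card < N} ≤
      av (fun x : Fin n → Option α => 2 ^ N * ∏ i, w (x i)) := by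
    refine av_mono fun x => ?_
    have hp : ∏ i, w (x i) = (1 / 2) ^ (Finset.univ.filter fun i => (x i).isSome).card := by
      simp only [w, Finset.prod_ite, Finset.prod_const, one_pow, mul_one]
    by_cases hx : x ∈ {x : Fin n → Option α | (Finset.univ.filter fun i => (x i).isSome).card < N}
    · rw [ind_of_mem hx, hp]
      calc (1 : ℝ) = 2 ^ N * (1 / 2) ^ N := by rw [← mul_pow]; norm_num
        _ ≤ _ := by
          refine mul_le_mul_of_nonneg_left ?_ (by positivity)
          exact pow_le_pow_of_le_one (by norm_num) (by norm_num) (le_of_lt hx)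
    · rw [ind_of_not_mem hx, hp]; positivity
  rw [av_mul, h1] at h2
  rw [lt_div_iff₀ (by positivity)] at hn
  linarith

/-- A dense insensitive set contains a subspace. -/
lemma insens_subspace [Finite α] [Nonempty α] (h : DHJ α) (a : α) (d : ℕ) (ε : ℝ) (hε : 0 < ε) :
    ∃ n : ℕ, ∀ D : Set (Fin n → Option α), Insens a D → ε ≤ dens D →
      ∃ V : Subspace (Fin d) (Option α) (Fin n), ∀ v, V v ∈ D := by
  classical
  cases nonempty_fintype α
  obtain ⟨N, hN⟩ := mdhj h d (ε / 2) (by positivity)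
  obtain ⟨n, hn⟩ := few (α := α) N (ε / 2) (by positivity)
  refine ⟨n, fun D hD hdens => ?_⟩
  set F : Set (Fin n → Option α) :=
    {x | (Finset.univ.filter fun i => (x i).isSome).card < N} with hF
  have h1 : 0 < ∑ x, (ind D x - ε / 2 - ind F x) := by
    have : av (fun x => ind D x - ε / 2 - ind F x) = dens D - ε / 2 - dens F := by
      rw [av_sub, av_sub, av_const]; rfl
    have h0 : 0 < av (fun x => ind D x - ε / 2 - ind F x) := by rw [this]; linarith
    rw [av_eq] at h0
    by_contra! H
    exact absurd h0 (not_lt.2 (div_nonpos_of_nonpos_of_nonneg H (by positivity)))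
  rw [sum_ext] at h1
  obtain ⟨J, -, hJ⟩ := Finset.exists_lt_of_sum_lt
    (lt_of_eq_of_lt (Finset.sum_const_zero (s := (Finset.univ : Finset (Finset (Fin n))))) h1)
  have hcard : ∀ z : J → α, (Finset.univ.filter fun i => (ext J z i).isSome) = J := by
    intro z; ext i; by_cases h : i ∈ J <;> simp [ext, h]
  have hJN : N ≤ J.card := by
    by_contra! hlt
    refine absurd hJ (not_lt.2 (Finset.sum_nonpos fun z _ => ?_))
    have : ext J z ∈ F := by rw [hF, Set.mem_ofPred_eq, hcard]; exact hlt
    rw [ind_of_mem this]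
    linarith [ind_le_one D (ext J z)]
  have hdJ : ε / 2 ≤ dens {z : J → α | ext J z ∈ D} := by
    have h0 : 0 ≤ av (fun z : J → α => ind D (ext J z) - ε / 2 - ind F (ext J z)) := by
      rw [av_eq]; exact div_nonneg hJ.le (by positivity)
    have h2 : av (fun z : J → α => ind D (ext J z) - ε / 2 - ind F (ext J z)) ≤
        av (fun z : J → α => ind {z : J → α | ext J z ∈ D} z - ε / 2) :=
      av_mono fun z => by
        have : ind D (ext J z) = ind {z : J → α | ext J z ∈ D} z := rfl
        linarith [ind_nonneg F (ext J z)]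
    rw [av_sub (fun z => ind {z : J → α | ext J z ∈ D} z), av_const] at h2
    change _ ≤ dens _ - _ at h2
    linarith
  obtain ⟨V, hV⟩ := hN J (by simpa using hJN) _ hdJ
  refine ⟨⟨fun i => if hi : i ∈ J then (V.idxFun ⟨i, hi⟩).map some id else Sum.inl none,
    fun e => ?_⟩, fun v => ?_⟩
  · obtain ⟨i, hi⟩ := V.proper e
    exact ⟨i, by simp [hi]⟩
  · refine hD _ _ (fun i => ?_) (hV (fun e => (v e).getD a))
    by_cases hi : i ∈ J
    · cases hV' : V.idxFun ⟨i, hi⟩ <;> simp [ext, hi, Subspace.apply_def, hV']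
    · simp [ext, hi, Subspace.apply_def]

/-- Nonpositive average on every `d`-dimensional subspace. -/
def NP {β ι : Type} (d : ℕ) (f : (ι → β) → ℝ) : Prop :=
  ∀ V : Subspace (Fin d) β ι, av (fun v => f (V v)) ≤ 0

lemma NP.comp {β ι ζ : Type} {d : ℕ} {f : (ι → β) → ℝ} (h : NP d f) (V : Subspace ζ β ι) :
    NP d (fun v => f (V v)) := by
  intro W
  have := h (compS V W)
  simpa only [compS_apply] using this

lemma av_range {X Y : Type} [Finite X] [Finite Y] (φ : X → Y) (hφ : Function.Injective φ)
    (g : Y → ℝ) (h : av (fun x => g (φ x)) ≤ 0) :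
    av (fun y => ind (Set.range φ) y * g y) ≤ 0 := by
  classical
  cases nonempty_fintype X
  cases nonempty_fintype Y
  rcases isEmpty_or_nonempty X with hX | hX
  · have : ∀ y, ind (Set.range φ) y * g y = 0 := fun y => by
      rw [ind_of_not_mem (by rintro ⟨x, -⟩; exact hX.false x), zero_mul]
    rw [av_eq]; simp [this]
  have hc : (0 : ℝ) < Fintype.card X := by exact_mod_cast Fintype.card_pos
  rw [av_eq, div_le_iff₀ hc, zero_mul] at h
  rw [av_eq]
  refine div_nonpos_of_nonpos_of_nonneg ?_ (by positivity)
  have : ∑ y, ind (Set.range φ) y * g y = ∑ x, g (φ x) := by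
    rw [← Finset.sum_image (f := g) (s := Finset.univ) (g := φ) (fun x _ y _ hxy => hφ hxy)]
    simp only [ind, ite_mul, one_mul, zero_mul]
    rw [← Finset.sum_filter]
    congr 1
    ext y; simp
  rw [this]; exact h

lemma dens_ge_of_mem {X : Type} [Finite X] {A : Set X} {x : X} (hx : x ∈ A) :
    1 / (Nat.card X : ℝ) ≤ dens A := by
  cases nonempty_fintype X
  rw [dens, av_eq, Nat.card_eq_fintype_card]
  gcongr
  rw [← ind_of_mem hx]
  exact Finset.single_le_sum (f := ind A) (fun x _ => ind_nonneg A x) (Finset.mem_univ x)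

lemma cover_aux [Finite α] [Nonempty α] (h : DHJ α) (a : α) (d : ℕ) (ε : ℝ) (hε : 0 < ε)
    (hε1 : ε ≤ 1) : ∃ c : ℝ, 0 < c ∧ c ≤ 1 ∧ ∀ j : ℕ, ∃ N : ℕ, ∀ (ι : Type) [Finite ι],
      N ≤ Nat.card ι → ∀ f : (ι → Option α) → ℝ, (∀ x, f x ≤ 1) → NP d f →
      ∀ D : Set (ι → Option α), Insens a D →
        av (fun x => f x * ind D x) ≤ (1 - c) ^ j * dens D + 2 * ε := by
  obtain ⟨n, hn⟩ := insens_subspace h a d ε hε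
  set L : ℝ := (Nat.card (Subspace (Fin d) (Option α) (Fin n)) : ℝ) with hL
  set K : ℝ := (Nat.card (Fin n → Option α) : ℝ) with hK
  have hL0 : 0 ≤ L := by positivity
  have hK1 : 1 ≤ K := by
    rw [hK]; exact_mod_cast Nat.card_pos (α := Fin n → Option α)
  have hc1 : ε / (L + 1) ≤ 1 := by
    rw [div_le_one (by positivity)]; linarith
  have hc0 : 0 < ε / (L + 1) := by positivity
  have hcc : 1 / K * (ε / (L + 1)) ≤ 1 := by
    have : 1 / K ≤ 1 := by rw [div_le_one (by positivity)]; exact hK1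
    exact mul_le_one₀ this hc0.le hc1
  refine ⟨1 / K * (ε / (L + 1)), by positivity, hcc, fun j => ?_⟩
  set c := 1 / K * (ε / (L + 1)) with hc
  have key : ∀ (ι : Type) [Finite ι] (f : (ι → Option α) → ℝ), (∀ x, f x ≤ 1) →
      ∀ D : Set (ι → Option α), av (fun x => f x * ind D x) ≤ dens D := by
    intro ι _ f hf D
    exact av_mono fun x => mul_le_of_le_one_left (ind_nonneg D x) (hf x)
  induction j with
  | zero =>
    refine ⟨0, fun ι _ _ f hf _ D _ => ?_⟩
    have := key ι f hf D
    simp; linarith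
  | succ j ih =>
    obtain ⟨N, hN⟩ := ih
    refine ⟨n + N, fun ι _ hι f hf hnp D hD => ?_⟩
    have hpow : 0 ≤ (1 - c) ^ j := pow_nonneg (by linarith) j
    by_cases hsmall : dens D ≤ 2 * ε
    · have h1 := key ι f hf D
      have h2 : 0 ≤ (1 - c) ^ (j + 1) * dens D :=
        mul_nonneg (pow_nonneg (by linarith) _) (dens_nonneg D)
      linarith
    push Not at hsmall
    obtain ⟨m, hm, ⟨e⟩⟩ := exists_split (Fin n) ι N (by simpa using hι)
    let pt : (Fin n → Option α) → (Fin m → Option α) → (ι → Option α) :=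
      fun x y => ofEquiv (Option α) e (Sum.elim x y)
    have hpre : ∀ x y, compS (ofEquiv (Option α) e) (pre x) y = pt x y := by
      intro x y; rw [compS_apply, pre_apply]
    have hsuf : ∀ x y, compS (ofEquiv (Option α) e) (suf y) x = pt x y := by
      intro x y; rw [compS_apply, suf_apply]
    have hav : ∀ g : (ι → Option α) → ℝ, av g = av (fun x => av (fun y => g (pt x y))) := by
      intro g
      rw [← av_relabel e, av_sumType]
    let Dx : (Fin n → Option α) → Set (Fin m → Option α) := fun x => {y | pt x y ∈ D}
    have hDx : ∀ x, Insens a (Dx x) := by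
      intro x
      have := hD.comp (compS (ofEquiv (Option α) e) (pre x))
      simpa only [hpre] using this
    have hDeq : dens D = av (fun x => dens (Dx x)) := hav (ind D)
    have hDens : 2 * ε ≤ av (fun y : Fin m → Option α =>
        dens {x : Fin n → Option α | pt x y ∈ D}) := by
      have : dens D = av (fun y : Fin m → Option α =>
        dens {x : Fin n → Option α | pt x y ∈ D}) := by
        unfold dens
        rw [hav, av_comm]
        rfl
      linarith
    obtain ⟨V, hV⟩ := popular (fun x y => pt x y ∈ D)
      (fun (V : Subspace (Fin d) (Option α) (Fin n)) B => ∀ v, V v ∈ B) hε hDens (by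
        intro y hy
        refine hn _ ?_ hy
        have := hD.comp (compS (ofEquiv (Option α) e) (suf y))
        simpa only [hsuf] using this)
    set T : Set (Fin m → Option α) := {y | ∀ v, V v ∈ {x | pt x y ∈ D}} with hT
    have hTi : Insens a T := by
      intro y y' hyy hy v
      exact hDx (V v) y y' hyy (hy v)
    let R : Set (Fin n → Option α) := Set.range (fun v => V v)
    let D' : (Fin n → Option α) → Set (Fin m → Option α) :=
      fun x => {y | y ∈ Dx x ∧ ¬ (x ∈ R ∧ y ∈ T)}
    have hD'i : ∀ x, Insens a (D' x) := by
      intro x y y' hyy hy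
      refine ⟨hDx x y y' hyy hy.1, fun hh => hy.2 ⟨hh.1, ?_⟩⟩
      exact hTi y' y (fun i => (hyy i).symm) hh.2
    have hsplit : ∀ x y, ind (Dx x) y = ind (D' x) y + ind R x * ind T y := by
      intro x y
      by_cases hR : x ∈ R <;> by_cases hy : y ∈ T
      · have h1 : y ∈ Dx x := by
          obtain ⟨v, rfl⟩ := hR
          exact hy v
        rw [ind_of_mem h1, ind_of_not_mem (fun hh => hh.2 ⟨hR, hy⟩), ind_of_mem hR, ind_of_mem hy]
        norm_num
      all_goals
        have hiff : y ∈ D' x ↔ y ∈ Dx x :=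
          ⟨fun hh => hh.1, fun hh => ⟨hh, fun h2 => by tauto⟩⟩
        have : ind (D' x) y = ind (Dx x) y := ind_congr hiff
        rw [this]
        simp [ind, hR, hy]
    -- the density drops
    have hdrop : av (fun x => dens (D' x)) ≤ dens D - c := by
      have h1 : dens D = av (fun x => dens (D' x)) + dens R * dens T := by
        rw [hDeq]
        have : ∀ x, dens (Dx x) = dens (D' x) + dens T * ind R x := by
          intro x
          have h2 : dens (Dx x) = av (fun y => ind (D' x) y + ind R x * ind T y) := by
            unfold dens; congr 1; funext y; exact hsplit x y
          rw [h2, av_add, av_mul, mul_comm (dens T)]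
          rfl
        simp only [this]
        rw [av_add, av_mul, mul_comm (dens R)]
        rfl
      have h2 : 1 / K ≤ dens R := dens_ge_of_mem ⟨fun _ => none, rfl⟩
      have h3 : c ≤ dens R * dens T := mul_le_mul h2 hV hc0.le (dens_nonneg R)
      linarith
    have hmain : av (fun x => f x * ind D x) =
        av (fun x => av (fun y => f (pt x y) * ind (D' x) y)) +
        av (fun y => ind T y * av (fun x => ind R x * f (pt x y))) := by
      rw [hav]
      have : ∀ x y, f (pt x y) * ind D (pt x y) =
          f (pt x y) * ind (D' x) y + ind T y * (ind R x * f (pt x y)) := by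
        intro x y
        have : ind D (pt x y) = ind (Dx x) y := rfl
        rw [this, hsplit]; ring
      simp only [this, av_add]
      rw [av_comm (fun x y => ind T y * (ind R x * f (pt x y)))]
      simp only [av_mul]
    have hneg : av (fun y => ind T y * av (fun x => ind R x * f (pt x y))) ≤ 0 := by
      have : av (fun y => ind T y * av (fun x => ind R x * f (pt x y))) ≤
          av (fun _ : Fin m → Option α => (0 : ℝ)) := by
        refine av_mono fun y => mul_nonpos_of_nonneg_of_nonpos (ind_nonneg T y) ?_
        refine av_range _ (subspace_injective V) (fun x => f (pt x y)) ?_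
        have := hnp (compS (compS (ofEquiv (Option α) e) (suf y)) V)
        simpa only [compS_apply _ V, hsuf] using this
      rwa [av_const] at this
    have hpos : av (fun x => av (fun y => f (pt x y) * ind (D' x) y)) ≤
        (1 - c) ^ j * av (fun x => dens (D' x)) + 2 * ε := by
      have : av (fun x => av (fun y => f (pt x y) * ind (D' x) y)) ≤
          av (fun x => (1 - c) ^ j * dens (D' x) + 2 * ε) := by
        refine av_mono fun x => ?_
        refine hN (Fin m) (by simpa using hm) (fun y => f (pt x y)) (fun y => hf _) ?_ _ (hD'i x)
        have := hnp.comp (compS (ofEquiv (Option α) e) (pre x))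
        simpa only [hpre] using this
      rwa [av_add, av_mul, av_const] at this
    have hD1 : dens D ≤ 1 := dens_le_one D
    have hcpos : 0 < c := by positivity
    have h5 : (1 - c) ^ j * av (fun x => dens (D' x)) ≤ (1 - c) ^ j * ((1 - c) * dens D) := by
      refine mul_le_mul_of_nonneg_left ?_ hpow
      nlinarith
    rw [hmain, pow_succ, mul_assoc]
    linarith

/-- Averages over insensitive sets are controlled by averages over subspaces. -/
lemma cover_single [Finite α] [Nonempty α] (h : DHJ α) (a : α) (d : ℕ) (ε : ℝ) (hε : 0 < ε) :
    ∃ N : ℕ, ∀ (ι : Type) [Finite ι],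
      N ≤ Nat.card ι → ∀ f : (ι → Option α) → ℝ, (∀ x, f x ≤ 1) → NP d f →
      ∀ D : Set (ι → Option α), Insens a D → av (fun x => f x * ind D x) ≤ ε := by
  obtain ⟨c, hc0, hc1, hc⟩ := cover_aux h a d (min (ε / 4) 1) (by positivity) (min_le_right _ _)
  obtain ⟨j, hj⟩ := exists_pow_lt_of_lt_one (show 0 < ε / 2 by positivity)
    (show 1 - c < 1 by linarith)
  obtain ⟨N, hN⟩ := hc j
  refine ⟨N, fun ι _ hι f hf hnp D hD => (hN ι hι f hf hnp D hD).trans ?_⟩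
  have h1 : (1 - c) ^ j * dens D ≤ (1 - c) ^ j :=
    mul_le_of_le_one_right (pow_nonneg (by linarith) _) (dens_le_one D)
  have h2 := min_le_left (ε / 4) 1
  linarith

lemma cover_all [Finite α] [Nonempty α] (h : DHJ α) (s : Finset α) : ∀ (d : ℕ) (ε : ℝ), 0 < ε →
    ∃ N : ℕ, ∀ (ι : Type) [Finite ι],
      N ≤ Nat.card ι → ∀ f : (ι → Option α) → ℝ, (∀ x, f x ≤ 1) → NP d f →
      ∀ D : α → Set (ι → Option α), (∀ a, Insens a (D a)) →
        av (fun x => f x * ind {x | ¬ ∀ a ∈ s, x ∈ D a} x) ≤ ε := by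
  classical
  induction s using Finset.induction_on with
  | empty =>
    intro d ε hε
    refine ⟨0, fun ι _ _ f hf _ D hD => ?_⟩
    have : ∀ x, f x * ind {x | ¬ ∀ a ∈ (∅ : Finset α), x ∈ D a} x = 0 := by
      intro x; simp [ind]
    simp only [this, av_const]
    exact hε.le
  | insert a s ha ih =>
    intro d ε hε
    obtain ⟨N1, hN1⟩ := cover_single h a d (ε / 3) (by positivity)
    obtain ⟨N2, hN2⟩ := ih N1 (ε / 3) (by positivity)
    refine ⟨max N1 N2, fun ι _ hι f hf hnp D hD => ?_⟩
    let g : (ι → Option α) → ℝ := fun x => f x * ind (D a) x - ε / 3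
    have hg1 : ∀ x, g x ≤ 1 := by
      intro x
      have h1 := mul_le_of_le_one_left (ind_nonneg (D a) x) (hf x)
      have h2 := ind_le_one (D a) x
      simp only [g]; linarith
    have hgn : NP N1 g := by
      intro V
      have h1 := hN1 (Fin N1) (by simp) (fun v => f (V v)) (fun v => hf _) (hnp.comp V) _
        ((hD a).comp V)
      have h2 : av (fun v => g (V v)) = av (fun v => f (V v) * ind {v | V v ∈ D a} v) - ε / 3 := by
        simp only [g]
        rw [av_sub, av_const]
        rfl
      rw [h2]; linarith
    have h1 := hN2 ι (le_trans (le_max_right _ _) hι) g hg1 hgn D hD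
    have h2 := hN1 ι (le_trans (le_max_left _ _) hι) f hf hnp _ (hD a).compl
    have h3 : av (fun x => f x * ind {x | ¬ ∀ b ∈ insert a s, x ∈ D b} x) ≤
        av (fun x => (f x * ind (D a)ᶜ x + g x * ind {x | ¬ ∀ a ∈ s, x ∈ D a} x) + ε / 3) := by
      refine av_mono fun x => ?_
      by_cases hx : x ∈ D a <;> by_cases hy : ∀ b ∈ s, x ∈ D b
      · have e1 : x ∉ {x | ¬ ∀ b ∈ insert a s, x ∈ D b} := by simpa using ⟨hx, hy⟩
        have e2 : x ∉ {x | ¬ ∀ b ∈ s, x ∈ D b} := by simpa using hy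
        rw [ind_of_not_mem e1, ind_of_not_mem e2, ind_of_not_mem (by simpa using hx)]
        linarith
      · have e1 : x ∈ {x | ¬ ∀ b ∈ insert a s, x ∈ D b} := by
          simp only [Set.mem_ofPred_eq, Finset.forall_mem_insert]; tauto
        have e2 : x ∈ {x | ¬ ∀ b ∈ s, x ∈ D b} := hy
        simp only [g]
        rw [ind_of_mem e1, ind_of_mem e2, ind_of_not_mem (A := (D a)ᶜ) (by simpa using hx),
          ind_of_mem hx]
        linarith
      · have e1 : x ∈ {x | ¬ ∀ b ∈ insert a s, x ∈ D b} := by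
          simp only [Set.mem_ofPred_eq, Finset.forall_mem_insert]; tauto
        have e2 : x ∉ {x | ¬ ∀ b ∈ s, x ∈ D b} := by simpa using hy
        rw [ind_of_mem e1, ind_of_not_mem e2, ind_of_mem (A := (D a)ᶜ) (by simpa using hx)]
        linarith
      · have e1 : x ∈ {x | ¬ ∀ b ∈ insert a s, x ∈ D b} := by
          simp only [Set.mem_ofPred_eq, Finset.forall_mem_insert]; tauto
        have e2 : x ∈ {x | ¬ ∀ b ∈ s, x ∈ D b} := hy
        simp only [g]
        rw [ind_of_mem e1, ind_of_mem e2, ind_of_mem (A := (D a)ᶜ) (by simpa using hx),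
          ind_of_not_mem hx]
        linarith
    rw [av_add, av_add, av_const] at h3
    linarith

end cover

lemma low_of_av {X : Type} [Finite X] {g : X → ℝ} {δ γ : ℝ} (hγ : 0 ≤ γ) (h : δ - γ ≤ av g)
    (hg : ∀ x, g x ≤ δ + γ) (x : X) : δ - 2 * Nat.card X * γ ≤ g x := by
  cases nonempty_fintype X
  have : Nonempty X := ⟨x⟩
  have h0 : (0 : ℝ) < Fintype.card X := by exact_mod_cast Fintype.card_pos
  rw [Nat.card_eq_fintype_card]
  rw [av_eq, le_div_iff₀ h0] at h
  have h1 : δ + γ - g x ≤ ∑ y, (δ + γ - g y) :=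
    Finset.single_le_sum (f := fun y => δ + γ - g y) (fun y _ => by linarith [hg y])
      (Finset.mem_univ x)
  rw [Finset.sum_sub_distrib] at h1
  simp at h1
  nlinarith

lemma extremal {α : Type} [Finite α] [Nonempty α] (h : DHJ α) (δ : ℝ) (hδ : 0 < δ)
    (hG : ∀ γ : ℝ, 0 < γ → Good (Option α) (δ + γ)) : ∃ γ : ℝ, 0 < γ ∧ Good (Option α) (δ - γ) := by
  classical
  cases nonempty_fintype α
  obtain ⟨m0, hm0⟩ := h (δ / 4) (by positivity)
  set L : ℝ := (Nat.card (Line α (Fin m0)) : ℝ) with hL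
  set θ : ℝ := δ / 4 / (L + 1) with hθ
  have hL0 : 0 ≤ L := by positivity
  have hθ0 : 0 < θ := by positivity
  set γ : ℝ := δ * θ / 8 with hγ
  have hγ0 : 0 < γ := by positivity
  set κ : ℝ := min (δ / 2) (δ * θ / 8) with hκ
  have hκ0 : 0 < κ := by positivity
  have hκ1 : κ ≤ δ / 2 := min_le_left _ _
  have hκ2 : κ ≤ δ * θ / 8 := min_le_right _ _
  obtain ⟨M1, hM1⟩ := hG γ hγ0
  obtain ⟨M, hM⟩ := cover_all h Finset.univ M1 (δ * θ / 8) (by positivity)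
  obtain ⟨I, hI, hHJ⟩ := Subspace.exists_mono_in_high_dimension (α ⊕ Fin m0) (Line α (Fin m0)) (Fin M)
  set K : ℝ := (Nat.card (I ⊕ Fin m0 → Option α) : ℝ) with hK
  have hK0 : 0 < K := by
    rw [hK]; exact_mod_cast Nat.card_pos (α := I ⊕ Fin m0 → Option α)
  have hγ2 : 0 < κ / (2 * K) := by positivity
  obtain ⟨N2, hN2⟩ := hG (κ / (2 * K)) hγ2
  refine ⟨κ / (2 * K), hγ2, Nat.card (I ⊕ Fin m0) + N2, fun ι _ hι A hA => ?_⟩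
  by_contra hno
  obtain ⟨m, hm, ⟨e⟩⟩ := exists_split (I ⊕ Fin m0) ι N2 hι
  let E : (I ⊕ Fin m0 → Option α) → Set (Fin m → Option α) :=
    fun x => {t | ofEquiv (Option α) e (Sum.elim x t) ∈ A}
  have hup : ∀ x, dens (E x) ≤ δ + κ / (2 * K) := by
    intro x
    by_contra! H
    obtain ⟨l, hl⟩ := hN2 (Fin m) (by simpa using hm) (E x) H.le
    refine hno ⟨compL (compS (ofEquiv (Option α) e) (pre x)) l, fun b => ?_⟩
    rw [compL_apply, compS_apply, pre_apply]
    exact hl b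
  have hAeq : dens A = av (fun x => dens (E x)) := by
    unfold dens
    rw [← av_relabel e, av_sumType]
    rfl
  have hlow : ∀ x, δ - κ ≤ dens (E x) := by
    intro x
    have h1 := low_of_av hγ2.le (hAeq ▸ hA) hup x
    have h2 : 2 * (Nat.card (I ⊕ Fin m0 → Option α) : ℝ) * (κ / (2 * K)) = κ := by
      rw [← hK]; field_simp
    rwa [h2] at h1
  -- a popular line for every parameter word
  let φ : (I → α ⊕ Fin m0) → (Fin m0 → α) → (I ⊕ Fin m0 → Option α) :=
    fun y z => Sum.elim (fun i => some ((y i).elim id z)) (fun j => some (z j))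
  have hline : ∀ y, ∃ l : Line α (Fin m0), θ ≤ dens {t | ∀ a, t ∈ E (φ y (l a))} := by
    intro y
    refine popular (fun z t => t ∈ E (φ y z)) (fun (l : Line α (Fin m0)) B => ∀ a, l a ∈ B)
      (by positivity) ?_ (fun t ht => hm0 (Fin m0) (by simp) _ ht)
    have h1 : av (fun t : Fin m → Option α => dens {z | t ∈ E (φ y z)}) =
        av (fun z => dens (E (φ y z))) := by
      unfold dens
      rw [av_comm]
      rfl
    have h2 : av (fun _ : Fin m0 → α => δ - κ) ≤ av (fun z => dens (E (φ y z))) :=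
      av_mono fun z => hlow _
    rw [av_const] at h2
    rw [h1]; linarith
  choose col hcol using hline
  obtain ⟨ψ, l, hl⟩ := hHJ col
  obtain ⟨j0, hj0⟩ := l.proper
  let V : Subspace (Fin M) (Option α) (I ⊕ Fin m0) :=
    { idxFun := Sum.elim
        (fun i => (ψ.idxFun i).elim (fun q => Sum.inl (q.elim some l.idxFun)) Sum.inr)
        (fun j => Sum.inl (l.idxFun j))
      proper := fun e => by
        obtain ⟨i, hi⟩ := ψ.proper e
        exact ⟨Sum.inl i, by simp [hi]⟩ }
  let s : Option α → α ⊕ Fin m0 := fun o => o.elim (Sum.inr j0) Sum.inl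
  let P : α → (Fin M → Option α) → (I ⊕ Fin m0 → Option α) := fun a u x => some ((V u x).getD a)
  have hP : ∀ a u, P a u = φ (ψ (fun i => s (u i))) (l a) := by
    intro a u
    funext x
    rcases x with i | j
    · cases hi : ψ.idxFun i with
      | inl q => cases q <;> simp [P, φ, V, Subspace.apply_def, hi]
      | inr i' => cases hu : u i' <;> simp [P, φ, V, Subspace.apply_def, hi, s, hu, hj0]
    · simp [P, φ, V, Subspace.apply_def]
  have hPd : ∀ u, θ ≤ dens {t | ∀ a, t ∈ E (P a u)} := by
    intro u
    have := hcol (ψ (fun i => s (u i)))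
    rw [hl] at this
    simpa only [hP] using this
  let A' : (Fin m → Option α) → Set (Fin M → Option α) := fun t => {u | t ∈ E (V u)}
  let D : (Fin m → Option α) → α → Set (Fin M → Option α) := fun t a => {u | t ∈ E (P a u)}
  let B : (Fin m → Option α) → Set (Fin M → Option α) := fun t => {u | ∀ a, t ∈ E (P a u)}
  have hDi : ∀ t a, Insens a (D t a) := by
    intro t a u u' huu hu
    have : P a u' = P a u := by
      funext x
      simp only [P]
      congr 1
      cases hx : V.idxFun x <;> simp [Subspace.apply_def, hx, huu]
    change t ∈ E (P a u')
    rw [this]; exact hu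
  have hdisj : ∀ t u, u ∈ A' t → u ∈ B t → False := by
    intro t u h1 h2
    let l0 : Line (Option α) (I ⊕ Fin m0) :=
      ⟨fun x => (V u x).map some, ⟨Sum.inr j0, by simp [V, Subspace.apply_def, hj0]⟩⟩
    refine hno ⟨compL (compS (ofEquiv (Option α) e) (suf t)) l0, fun b => ?_⟩
    rw [compL_apply, compS_apply, suf_apply]
    cases b with
    | none =>
      have : l0 none = V u := by
        funext x
        rw [Line.coe_apply]
        simp only [l0]
        cases V u x <;> rfl
      rw [this]; exact h1
    | some a =>
      have : l0 (some a) = P a u := by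
        funext x
        rw [Line.coe_apply]
        simp only [l0, P]
        cases V u x <;> rfl
      rw [this]; exact h2 a
  have hmain : ∀ t, dens (A' t) ≤ (δ + γ) * (1 - dens (B t)) + δ * θ / 8 := by
    intro t
    have h1 := hM (Fin M) (by simp) (fun u => ind (A' t) u - (δ + γ))
      (fun u => by linarith [ind_le_one (A' t) u]) (by
        intro W
        rw [av_sub (fun v => ind (A' t) (W v)), av_const]
        change dens {v | W v ∈ A' t} - _ ≤ 0
        by_contra! H
        obtain ⟨l', hl'⟩ := hM1 (Fin M1) (by simp) {v | W v ∈ A' t} (by linarith)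
        refine hno ⟨compL (compS (ofEquiv (Option α) e) (compS (suf t) (compS V W))) l',
          fun b => ?_⟩
        rw [compL_apply, compS_apply, compS_apply, compS_apply, suf_apply]
        exact hl' b) (D t) (hDi t)
    have h2 : av (fun u => (ind (A' t) u - (δ + γ)) *
        ind {u | ¬ ∀ a ∈ Finset.univ, u ∈ D t a} u) =
        av (fun u => ind (A' t) u - (δ + γ) * (1 - ind (B t) u)) := by
      congr 1
      funext u
      by_cases hB : u ∈ B t
      · have e1 : u ∉ {u | ¬ ∀ a ∈ Finset.univ, u ∈ D t a} := fun hh => hh fun a _ => hB a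
        rw [ind_of_not_mem e1, ind_of_mem hB, ind_of_not_mem (fun hh => hdisj t u hh hB)]
        ring
      · have e1 : u ∈ {u | ¬ ∀ a ∈ Finset.univ, u ∈ D t a} :=
          fun hh => hB fun a => hh a (Finset.mem_univ a)
        rw [ind_of_mem e1, ind_of_not_mem hB]
        ring
    rw [h2, av_sub, av_mul, av_sub, av_const] at h1
    change dens (A' t) - (δ + γ) * (1 - dens (B t)) ≤ _ at h1
    linarith
  have hav1 : δ - κ ≤ av (fun t => dens (A' t)) := by
    have h1 : av (fun t => dens (A' t)) = av (fun u => dens (E (V u))) := by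
      unfold dens
      rw [av_comm]
      rfl
    have h2 : av (fun _ : Fin M → Option α => δ - κ) ≤ av (fun u => dens (E (V u))) :=
      av_mono fun u => hlow _
    rw [av_const] at h2
    rw [h1]; exact h2
  have hav2 : θ ≤ av (fun t => dens (B t)) := by
    have h1 : av (fun t => dens (B t)) = av (fun u => dens {t | ∀ a, t ∈ E (P a u)}) := by
      unfold dens
      rw [av_comm]
      rfl
    have h2 : av (fun _ : Fin M → Option α => θ) ≤ av (fun u => dens {t | ∀ a, t ∈ E (P a u)}) :=
      av_mono hPd
    rw [av_const] at h2
    rw [h1]; exact h2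
  have hav3 := av_mono hmain
  rw [av_add, av_mul, av_sub, av_const, av_const] at hav3
  have hp : 0 < δ * θ := by positivity
  have h9 : (δ + γ) * (1 - av (fun t => dens (B t))) ≤ (δ + γ) * (1 - θ) :=
    mul_le_mul_of_nonneg_left (by linarith) (by positivity)
  nlinarith

lemma Good.mono {β : Type} {δ δ' : ℝ} (h : Good β δ) (hd : δ ≤ δ') : Good β δ' := by
  obtain ⟨N, hN⟩ := h
  exact ⟨N, fun ι _ hι A hA => hN ι hι A (hd.trans hA)⟩

lemma dhj_option {α : Type} [Finite α] [Nonempty α] (h : DHJ α) : DHJ (Option α) := by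
  by_contra hcon
  unfold DHJ at hcon
  push Not at hcon
  obtain ⟨δ0, hδ0, hbad⟩ := hcon
  let S : Set ℝ := {δ | Good (Option α) δ}
  have hne : S.Nonempty := ⟨2, 0, fun ι _ _ A hA => by linarith [dens_le_one A]⟩
  have hlb : ∀ δ ∈ S, δ0 ≤ δ := by
    intro δ hδ
    by_contra! H
    exact hbad (Good.mono hδ H.le)
  have hbdd : BddBelow S := ⟨δ0, hlb⟩
  have hpos : δ0 ≤ sInf S := le_csInf hne hlb
  obtain ⟨γ, hγ, hg⟩ := extremal h (sInf S) (by linarith) (fun γ hγ => by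
    obtain ⟨δ, hδ, hlt⟩ := exists_lt_of_csInf_lt hne (show sInf S < sInf S + γ by linarith)
    exact Good.mono hδ hlt.le)
  have := csInf_le hbdd hg
  linarith

/-- The density Hales-Jewett theorem. -/
theorem dhj (α : Type) [Finite α] : DHJ α := by
  refine Finite.induction_empty_option (P := fun α => DHJ α) ?_ ?_ ?_ α
  · intro α β e hα δ hδ
    obtain ⟨N, hN⟩ := hα δ hδ
    refine ⟨N, fun ι _ hι A hA => ?_⟩
    obtain ⟨l, hl⟩ := hN ι hι {x : ι → α | (fun i => e (x i)) ∈ A} (by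
      refine hA.trans_eq ?_
      rw [dens, dens, ← av_equiv (Equiv.arrowCongr (Equiv.refl ι) e) (ind A)]
      congr 1)
    refine ⟨l.map e, fun b => ?_⟩
    have h1 : l.map e b = e ∘ l (e.symm b) := by
      rw [← Line.map_apply, e.apply_symm_apply]
    rw [h1]
    exact hl (e.symm b)
  · intro δ hδ
    refine ⟨1, fun ι _ hι A hA => ?_⟩
    have : Nonempty ι := (Nat.card_pos_iff.1 hι).1
    exact ⟨Line.diagonal _ _, fun b => b.elim⟩
  · intro α _ hα
    rcases isEmpty_or_nonempty α with hE | hE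
    · intro δ hδ
      refine ⟨1, fun ι _ hι A hA => ?_⟩
      have : Nonempty ι := (Nat.card_pos_iff.1 hι).1
      obtain ⟨x, hx⟩ := nonempty_of_dens_pos (hδ.trans_le hA)
      refine ⟨Line.diagonal _ _, fun b => ?_⟩
      rwa [Subsingleton.elim (Line.diagonal (Option α) ι b) x]
    · exact dhj_option hα

lemma dens_eq {X : Type*} [Finite X] (A : Set X) : dens A = Nat.card A / Nat.card X := by
  classical
  cases nonempty_fintype X
  rw [dens, av_eq, Nat.card_eq_fintype_card, Nat.card_eq_fintype_card]
  congr 1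
  simp [ind, Fintype.card_subtype]

lemma line_sum {k N p : ℕ} (l : Line (Fin k) (Fin N)) (hp : N < p) :
    ∃ c d : ZMod p, d ≠ 0 ∧ ∀ b : Fin k,
      ∑ j, (((l b j : Fin k) : ℕ) : ZMod p) = c + ((b : ℕ) : ZMod p) * d := by
  classical
  let W : Finset (Fin N) := Finset.univ.filter fun j => l.idxFun j = none
  refine ⟨∑ j, (match l.idxFun j with
      | none => 0
      | some y => ((y : ℕ) : ZMod p)), (W.card : ZMod p), ?_, ?_⟩
  · intro h0
    rw [ZMod.natCast_eq_zero_iff] at h0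
    have hpos : 0 < W.card := by
      obtain ⟨j, hj⟩ := l.proper
      exact Finset.card_pos.2 ⟨j, by simp [W, hj]⟩
    have h1 := Nat.le_of_dvd hpos h0
    have h2 : W.card ≤ N := by simpa using Finset.card_le_univ W
    omega
  · intro b
    have h3 : ((b : ℕ) : ZMod p) * (W.card : ZMod p)
        = ∑ j, if l.idxFun j = none then ((b : ℕ) : ZMod p) else 0 := by
      rw [← Finset.sum_filter, Finset.sum_const, nsmul_eq_mul, mul_comm]
    rw [h3, ← Finset.sum_add_distrib]
    refine Finset.sum_congr rfl fun j _ => ?_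
    rcases hj : l.idxFun j with _ | y
    · rw [Line.apply_none _ _ _ hj]; simp
    · rw [Line.apply_some hj]; simp

lemma szem (k : ℕ) (hk : 0 < k) (δ : ℝ) (hδ : 0 < δ) :
    ∃ N : ℕ, ∀ p : ℕ, p.Prime → N < p → ∀ A : Set (ZMod p), δ * p ≤ Nat.card A →
      ∃ x d : ZMod p, d ≠ 0 ∧ ∀ i : ℕ, i < k → x + (i : ZMod p) * d ∈ A := by
  obtain ⟨N, hN⟩ := dhj (Fin k) δ hδ
  refine ⟨N, fun p hp hNp A hA => ?_⟩
  have : NeZero p := ⟨hp.ne_zero⟩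
  have : Nonempty (Fin k) := ⟨⟨0, hk⟩⟩
  have hp0 : (0 : ℝ) < p := by exact_mod_cast hp.pos
  have hdA : δ ≤ dens A := by
    rw [dens_eq, Nat.card_zmod, le_div_iff₀ hp0]; exact hA
  let s : (Fin N → Fin k) → ZMod p := fun x => ∑ j, (((x j : Fin k) : ℕ) : ZMod p)
  have hav : av (fun a : ZMod p => dens {x : Fin N → Fin k | a + s x ∈ A}) = dens A := by
    unfold dens
    rw [av_comm (fun (a : ZMod p) (x : Fin N → Fin k) => ind {x | a + s x ∈ A} x)]
    rw [← av_const (X := Fin N → Fin k) (av (ind A))]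
    congr 1
    funext x
    rw [← av_equiv (Equiv.addRight (s x)) (ind A)]
    congr 1
  obtain ⟨a, ha⟩ := exists_ge_of_av (hdA.trans_eq hav.symm)
  obtain ⟨l, hl⟩ := hN (Fin N) (by simp) _ ha
  obtain ⟨c, d, hd, hs⟩ := line_sum (p := p) l hNp
  refine ⟨a + c, d, hd, fun i hi => ?_⟩
  have h1 : a + s (l ⟨i, hi⟩) ∈ A := hl ⟨i, hi⟩
  have h2 : s (l ⟨i, hi⟩) = c + (i : ZMod p) * d := hs ⟨i, hi⟩
  rwa [h2, ← add_assoc] at h1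

end Szem

/-- For every positive integer k, the pair (k, 1) is findable. -/
theorem statement2 (k : ℕ) (hk : 0 < k) : Findable k 1 := by
  classical
  intro δ hδ
  obtain ⟨N, hN⟩ := Szem.szem k hk δ hδ
  refine ⟨N + 1, fun p hp hNp A hA hAc => ?_⟩
  have : Fact p.Prime := ⟨hp⟩
  have hp0 : (0 : ℝ) < p := by exact_mod_cast hp.pos
  obtain ⟨x, d, hd, hx⟩ := hN p hp hNp A hA
  have hpos : 0 < Nat.card ↥(Aᶜ) := by
    have : (0 : ℝ) < Nat.card ↥(Aᶜ) := (mul_pos hδ hp0).trans_le hAc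
    exact_mod_cast this
  obtain ⟨⟨y, hy⟩⟩ := (Nat.card_pos_iff.1 hpos).1
  have hex : ∃ i : ℕ, x + (i : ZMod p) * d ∉ A := by
    refine ⟨((y - x) / d).val, ?_⟩
    rw [ZMod.natCast_zmod_val, div_mul_cancel₀ _ hd, add_sub_cancel]
    exact hy
  obtain ⟨m, hm, hmin⟩ : ∃ m : ℕ, x + (m : ZMod p) * d ∉ A ∧
      ∀ i : ℕ, i < m → x + (i : ZMod p) * d ∈ A :=
    ⟨Nat.find hex, Nat.find_spec hex, fun i hi => not_not.1 (Nat.find_min hex hi)⟩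
  have hkm : k ≤ m := by
    by_contra! H
    exact hm (hx m H)
  obtain ⟨r, rfl⟩ := Nat.exists_eq_add_of_le hkm
  have key : ∀ i : ℕ, x + (r : ZMod p) * d + (i : ZMod p) * d
      = x + ((r + i : ℕ) : ZMod p) * d := by
    intro i; push_cast; ring
  refine ⟨x + (r : ZMod p) * d, d, hd, fun i hi => ?_, fun i hi hi2 => ?_⟩
  · rw [key]; exact hmin _ (by omega)
  · obtain rfl : i = k := by omega
    rw [key, add_comm r i]; exact hm
end

section
/- For every real δ < 1/2 there exists p₁ such that for every prime p ≥ p₁ there is a red–blue colouring of ℤ/pℤ in which each colour class has at least δ·p elements and which contains no (14,14)-AP. In particular, the pair (14,14) is not findable. -/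
namespace FourteenAP

/-- Fourteen red points followed by fourteen blue points. -/
def Bad (P : ℝ → Prop) (x θ : ℝ) : Prop :=
  (∀ i : ℕ, i < 14 → P (x + i * θ)) ∧ (∀ i : ℕ, 14 ≤ i → i < 28 → ¬ P (x + i * θ))

/-- `P` follows the self-similar pattern on `[-1,1]` to depth `n`
(red to the left of the cell, blue to the right). -/
def Cell : ℕ → (ℝ → Prop) → Prop
  | 0, _ => True
  | n + 1, P =>
    (∀ y, 1/7 ≤ y → y ≤ 4/7 → P y) ∧
    (∀ y, -(4/7) ≤ y → y ≤ -(1/7) → ¬ P y) ∧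
    Cell n (fun y => ¬ P (1/7 * y + 0)) ∧
    Cell n (fun y => P (3/14 * y + 11/14)) ∧
    Cell n (fun y => P (3/14 * y + (-(11/14))))

theorem Bad.scale {P Q : ℝ → Prop} {x θ : ℝ} (k t : ℝ) (hk : 0 < k)
    (hPQ : ∀ y, P (k * y + t) ↔ Q y) (h : Bad P x θ) : Bad Q ((x - t) / k) (θ / k) := by
  have e : ∀ i : ℕ, k * ((x - t) / k + i * (θ / k)) + t = x + i * θ := by
    intro i; field_simp; ring
  refine ⟨fun i hi => ?_, fun i hi hi' => ?_⟩
  · rw [← hPQ, e]; exact h.1 i hi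
  · rw [← hPQ, e]; exact h.2 i hi hi'

/-- An AP which does not hit a long block stays to the left of it. -/
theorem nojump_up {x θ u v : ℝ} (hv : θ ≤ v - u) (a b : ℕ) (hab : a ≤ b)
    (h0 : x + a * θ < u)
    (h : ∀ i : ℕ, a ≤ i → i ≤ b → u ≤ x + i * θ → x + i * θ ≤ v → False) :
    x + b * θ < u := by
  induction b, hab using Nat.le_induction with
  | base => exact h0
  | succ b hab ih =>
    have h1 := ih (fun i hi hi' => h i hi (by omega))
    by_contra hc
    push Not at hc
    refine h (b + 1) (by omega) le_rfl hc ?_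
    push_cast at hc ⊢
    linarith

/-- An AP which does not hit a long block stays to the right of it. -/
theorem nojump_down {x θ u v : ℝ} (hv : θ ≤ v - u) (a b : ℕ) (hab : a ≤ b)
    (h0 : v < x + b * θ)
    (h : ∀ i : ℕ, a ≤ i → i ≤ b → u ≤ x + i * θ → x + i * θ ≤ v → False) :
    v < x + a * θ := by
  induction b, hab using Nat.le_induction with
  | base => exact h0
  | succ b hab ih =>
    refine ih ?_ (fun i hi hi' => h i hi (by omega))
    by_contra hc
    push Not at hc
    refine h b (by omega) (by omega) ?_ hc
    push_cast at h0
    linarith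

theorem core (n : ℕ) :
    (∀ (P : ℝ → Prop) (x θ : ℝ), Cell (n + 2) P → (3/14 : ℝ) ^ n < θ → Bad P x θ → θ ≤ 3/7 →
      x + 13 * θ ≤ 1 → -1 ≤ x + 14 * θ → False) ∧
    (∀ (P : ℝ → Prop) (x θ : ℝ), Cell (n + 2) P → (3/14 : ℝ) ^ n < θ →
      Bad (fun y => ¬ P y) x θ → -1 ≤ x → x + 27 * θ ≤ 1 → False) := by
  induction n with
  | zero =>
    refine ⟨?_, ?_⟩
    · intro P x θ _ h _ h2 _ _
      norm_num at h; linarith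
    · intro P x θ _ h _ h2 h3
      norm_num at h; linarith
  | succ n ih =>
    obtain ⟨ih1, ih2⟩ := ih
    have up : ∀ θ : ℝ, (3/14 : ℝ) ^ (n + 1) < θ →
        0 < θ ∧ (3/14 : ℝ) ^ n < θ / (3/14) ∧ (3/14 : ℝ) ^ n < θ / (1/7) := by
      intro θ h
      have h0 : (0 : ℝ) < (3/14 : ℝ) ^ n := by positivity
      rw [pow_succ] at h
      have hθ : 0 < θ := by linarith
      refine ⟨hθ, ?_, ?_⟩
      · rw [lt_div_iff₀ (by norm_num)]; exact h
      · rw [lt_div_iff₀ (by norm_num)]; linarith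
    refine ⟨?_, ?_⟩
    · intro P x θ hC hθ hB hle h13 h14
      obtain ⟨hpos, hs1, hs2⟩ := up θ hθ
      obtain ⟨hR, hBl, hM, hO1, hO2⟩ := hC
      have r13 := hB.1 13 (by norm_num)
      have b14 := hB.2 14 (by norm_num) (by norm_num)
      push_cast at r13 b14
      rcases lt_or_ge (x + 14 * θ) (1/7) with hlt | hge
      · have h27 : x + (27 : ℕ) * θ < 1/7 := by
          refine nojump_up (v := 4/7) (by linarith) 14 27 (by norm_num) (by push_cast; linarith) ?_
          intro i hi hi' hu hv
          exact hB.2 i hi (by omega) (hR _ hu hv)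
        push_cast at h27
        rcases lt_or_ge (x + 13 * θ) (-(4/7)) with h | h
        · refine ih1 _ ((x - (-(11/14))) / (3/14)) (θ / (3/14)) hO2 hs1
            (hB.scale (3/14) (-(11/14)) (by norm_num) (fun y => Iff.rfl)) ?_ ?_ ?_ <;> linarith
        · have h' : -(1/7) < x + 13 * θ := by
            by_contra hc
            push Not at hc
            exact hBl _ h hc r13
          have h0 : -(1/7) < x + (0 : ℕ) * θ := by
            refine nojump_down (u := -(4/7)) (by linarith) 0 13 (by norm_num)
              (by push_cast; linarith) ?_
            intro i hi hi' hu hv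
            exact hBl _ hu hv (hB.1 i (by omega))
          push_cast at h0
          refine ih2 _ ((x - 0) / (1/7)) (θ / (1/7)) hM hs2
            (hB.scale (1/7) 0 (by norm_num) (fun y => not_not.symm)) ?_ ?_ <;> linarith
      · have h' : 4/7 < x + 14 * θ := by
          by_contra hc
          push Not at hc
          exact b14 (hR _ hge hc)
        have h0 : -(1/7) < x + (0 : ℕ) * θ := by
          refine nojump_down (u := -(4/7)) (by linarith) 0 13 (by norm_num)
            (by push_cast; linarith) ?_
          intro i hi hi' hu hv
          exact hBl _ hu hv (hB.1 i (by omega))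
        push_cast at h0
        refine ih1 _ ((x - 11/14) / (3/14)) (θ / (3/14)) hO1 hs1
            (hB.scale (3/14) (11/14) (by norm_num) (fun y => Iff.rfl)) ?_ ?_ ?_ <;> linarith
    · intro P x θ hC hθ hB h0 h27
      obtain ⟨hpos, hs1, hs2⟩ := up θ hθ
      obtain ⟨hR, hBl, hM, hO1, hO2⟩ := hC
      have b13 := hB.1 13 (by norm_num)
      have r14 := hB.2 14 (by norm_num) (by norm_num)
      push_cast at b13 r14
      simp only [not_not] at r14
      rcases lt_or_ge (x + 14 * θ) (-(4/7)) with h | h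
      · have h27 : x + (27 : ℕ) * θ < -(4/7) := by
          refine nojump_up (v := -(1/7)) (by linarith) 14 27 (by norm_num)
            (by push_cast; linarith) ?_
          intro i hi hi' hu hv
          exact hB.2 i hi (by omega) (hBl _ hu hv)
        push_cast at h27
        refine ih2 _ ((x - (-(11/14))) / (3/14)) (θ / (3/14)) hO2 hs1
            (hB.scale (3/14) (-(11/14)) (by norm_num) (fun y => Iff.rfl)) ?_ ?_ <;> linarith
      · have h14 : -(1/7) < x + 14 * θ := by
          by_contra hc
          push Not at hc
          exact hBl _ h hc r14
        rcases lt_or_ge (4/7) (x + 13 * θ) with g | g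
        · have h0' : 4/7 < x + (0 : ℕ) * θ := by
            refine nojump_down (u := 1/7) (by linarith) 0 13 (by norm_num)
              (by push_cast; linarith) ?_
            intro i hi hi' hu hv
            exact hB.1 i (by omega) (hR _ hu hv)
          push_cast at h0'
          refine ih2 _ ((x - 11/14) / (3/14)) (θ / (3/14)) hO1 hs1
            (hB.scale (3/14) (11/14) (by norm_num) (fun y => Iff.rfl)) ?_ ?_ <;> linarith
        · have h13 : x + 13 * θ < 1/7 := by
            by_contra hc
            push Not at hc
            exact b13 (hR _ hc g)
          have a0 : -(11/14) + 3/14 * (4/7) < x + (0 : ℕ) * θ := by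
            refine nojump_down (u := -(11/14) + 3/14 * (1/7)) (by linarith) 0 13 (by norm_num)
              (by push_cast; linarith) ?_
            intro i hi hi' hu hv
            have := hO2.1 ((x + i * θ + 11/14) / (3/14)) (by linarith) (by linarith)
            refine hB.1 i (by omega) ?_
            convert this using 1
            ring
          have a27 : x + (27 : ℕ) * θ < 11/14 - 3/14 * (4/7) := by
            refine nojump_up (v := 11/14 - 3/14 * (1/7)) (by linarith) 14 27 (by norm_num)
              (by push_cast; linarith) ?_
            intro i hi hi' hu hv
            have := hO1.2.1 ((x + i * θ - 11/14) / (3/14)) (by linarith) (by linarith)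
            refine hB.2 i hi (by omega) ?_
            have e : 3/14 * ((x + i * θ - 11/14) / (3/14)) + 11/14 = x + i * θ := by ring
            beta_reduce at this
            rwa [e] at this
          push_cast at a0 a27
          refine ih1 _ ((x - 0) / (1/7)) (θ / (1/7)) hM hs2
            (hB.scale (1/7) 0 (by norm_num) (fun y => Iff.rfl)) ?_ ?_ ?_ <;> linarith

/-- Alternating colours along fourteen points. -/
def Alt (P Q : ℝ → Prop) (z ε : ℝ) : Prop :=
  ∀ i : ℕ, i < 13 → (P (z + i * ε) ∧ ¬ Q (z + (i + 1 : ℕ) * ε)) ∨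
    (¬ Q (z + i * ε) ∧ P (z + (i + 1 : ℕ) * ε))

theorem Alt.scale {P Q P' Q' : ℝ → Prop} {x θ : ℝ} (k t : ℝ) (hk : 0 < k)
    (hP : ∀ y, P (k * y + t) ↔ P' y) (hQ : ∀ y, Q (k * y + t) ↔ Q' y) (h : Alt P Q x θ) :
    Alt P' Q' ((x - t) / k) (θ / k) := by
  have e : ∀ i : ℕ, k * ((x - t) / k + i * (θ / k)) + t = x + i * θ := by
    intro i; field_simp; ring
  intro i hi
  rw [← hP, ← hP, ← hQ, ← hQ, e, e]
  exact h i hi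

theorem Alt.neg {P Q : ℝ → Prop} {x θ : ℝ} (h : Alt P Q x θ) :
    Alt (fun y => ¬ Q y) (fun y => ¬ P y) x θ := by
  intro i hi
  have := h i hi
  tauto

theorem dich {z ε u v : ℝ} (hε : 0 < ε) (hv : 2 * ε ≤ v - u)
    (h : ∀ i : ℕ, i < 13 → u ≤ z + i * ε → z + (i + 1 : ℕ) * ε ≤ v → False) :
    z + 12 * ε < u ∨ v < z + ε := by
  by_contra hc
  push Not at hc
  obtain ⟨h1, h2⟩ := hc
  have key : ∀ i : ℕ, i ≤ 12 → z + i * ε < u := by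
    intro i
    induction i with
    | zero =>
      intro _
      by_contra hc
      push Not at hc
      exact h 0 (by norm_num) hc (by push_cast; linarith)
    | succ i ih =>
      intro hi
      have h3 := ih (by omega)
      by_contra hc
      push Not at hc
      refine h (i + 1) (by omega) hc ?_
      push_cast
      linarith
  have := key 12 le_rfl
  push_cast at this
  linarith

theorem Alt.dich {P Q : ℝ → Prop} {z ε u v : ℝ} (h : Alt P Q z ε) (hε : 0 < ε)
    (hv : 2 * ε ≤ v - u)
    (hb : (∀ y, u ≤ y → y ≤ v → P y ∧ Q y) ∨ (∀ y, u ≤ y → y ≤ v → ¬ P y ∧ ¬ Q y)) :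
    z + 12 * ε < u ∨ v < z + ε := by
  refine FourteenAP.dich hε hv ?_
  intro i hi h1 h2
  have e : z + (i + 1 : ℕ) * ε = z + i * ε + ε := by push_cast; ring
  have := h i hi
  rcases hb with hb | hb
  · have g1 := hb (z + i * ε) h1 (by linarith)
    have g2 := hb (z + (i + 1 : ℕ) * ε) (by linarith) h2
    tauto
  · have g1 := hb (z + i * ε) h1 (by linarith)
    have g2 := hb (z + (i + 1 : ℕ) * ε) (by linarith) h2
    tauto

theorem altCore (n : ℕ) : ∀ (P Q : ℝ → Prop) (z ε : ℝ), Cell n P → Cell n Q →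
    (3/14 : ℝ) ^ n < ε → Alt P Q z ε → -1 ≤ z + ε → z + 12 * ε ≤ 1 → False := by
  induction n with
  | zero =>
    intro P Q z ε _ _ h _ h1 h2
    norm_num at h; linarith
  | succ n ih =>
    intro P Q z ε hP hQ hε hA h1 h12
    have h0 : (0 : ℝ) < (3/14 : ℝ) ^ n := by positivity
    rw [pow_succ] at hε
    have hpos : 0 < ε := by linarith
    have hs1 : (3/14 : ℝ) ^ n < ε / (3/14) := by
      rw [lt_div_iff₀ (by norm_num)]; exact hε
    have hs2 : (3/14 : ℝ) ^ n < ε / (1/7) := by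
      rw [lt_div_iff₀ (by norm_num)]; linarith
    obtain ⟨pR, pB, pM, pO1, pO2⟩ := hP
    obtain ⟨qR, qB, qM, qO1, qO2⟩ := hQ
    rcases hA.dich (u := -(4/7)) (v := -(1/7)) hpos (by linarith)
      (Or.inr fun y hy hy' => ⟨pB y hy hy', qB y hy hy'⟩) with g | g
    · refine ih _ _ ((z - (-(11/14))) / (3/14)) (ε / (3/14)) pO2 qO2 hs1
        (hA.scale (3/14) (-(11/14)) (by norm_num) (fun y => Iff.rfl) (fun y => Iff.rfl)) ?_ ?_
        <;> linarith
    rcases hA.dich (u := 1/7) (v := 4/7) hpos (by linarith)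
      (Or.inl fun y hy hy' => ⟨pR y hy hy', qR y hy hy'⟩) with g' | g'
    · refine ih _ _ ((z - 0) / (1/7)) (ε / (1/7)) qM pM hs2
        (hA.neg.scale (1/7) 0 (by norm_num) (fun y => Iff.rfl) (fun y => Iff.rfl)) ?_ ?_
        <;> linarith
    · refine ih _ _ ((z - 11/14) / (3/14)) (ε / (3/14)) pO1 qO1 hs1
        (hA.scale (3/14) (11/14) (by norm_num) (fun y => Iff.rfl) (fun y => Iff.rfl)) ?_ ?_
        <;> linarith

/-- The colouring pattern on a circle of length `8`. -/
structure Top (n : ℕ) (P : ℝ → Prop) : Prop where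
  per : Function.Periodic P 8
  blue : ∀ y, 1 ≤ y → y ≤ 3 → ¬ P y
  red : ∀ y, 5 ≤ y → y ≤ 7 → P y
  cell0 : Cell n P
  cell1 : Cell n (fun y => ¬ P (y + 4))

theorem Cell.symm (n : ℕ) : ∀ P : ℝ → Prop, Cell n P → Cell n (fun y => ¬ P (-y)) := by
  induction n with
  | zero => intro P _; trivial
  | succ n ih =>
    intro P h
    obtain ⟨hR, hB, hM, hO1, hO2⟩ := h
    refine ⟨fun y h1 h2 => hB _ (by linarith) (by linarith),
      fun y h1 h2 => not_not.2 (hR _ (by linarith) (by linarith)), ?_, ?_, ?_⟩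
    · convert ih _ hM using 4
      ring_nf
    · convert ih _ hO2 using 4
      ring_nf
    · convert ih _ hO1 using 4
      ring_nf

theorem Top.reflect {n : ℕ} {P : ℝ → Prop} (h : Top n P) : Top n (fun y => P (4 - y)) := by
  refine ⟨?_, ?_, ?_, ?_, ?_⟩
  · intro y
    show P (4 - (y + 8)) = P (4 - y)
    rw [← h.per (4 - (y + 8))]
    congr 1; ring
  · intro y h1 h2
    exact h.blue _ (by linarith) (by linarith)
  · intro y h1 h2
    show P (4 - y)
    rw [← h.per (4 - y)]
    exact h.red _ (by linarith) (by linarith)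
  · convert Cell.symm n _ h.cell1 using 2
    rw [not_not]
    ring_nf
  · convert Cell.symm n _ h.cell0 using 4
    ring_nf

theorem Top.red' {n : ℕ} {P : ℝ → Prop} (h : Top n P) : ∀ y, -3 ≤ y → y ≤ -1 → P y := by
  intro y h1 h2
  rw [← h.per y]
  exact h.red _ (by linarith) (by linarith)

theorem Top.blue' {n : ℕ} {P : ℝ → Prop} (h : Top n P) : ∀ y, -7 ≤ y → y ≤ -5 → ¬ P y := by
  intro y h1 h2
  rw [← h.per y]
  exact h.blue _ (by linarith) (by linarith)

theorem Top.turn {n : ℕ} {P : ℝ → Prop} (h : Top n P) : Top n (fun y => ¬ P (y + 4)) := by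
  have e : ∀ y, P (y + 4 + 4) = P y := by
    intro y
    rw [← h.per y]; congr 1; ring
  refine ⟨?_, ?_, ?_, h.cell1, ?_⟩
  · intro y
    show (¬ P (y + 8 + 4)) = ¬ P (y + 4)
    rw [← h.per (y + 4)]
    congr 2; ring
  · intro y h1 h2
    exact not_not.2 (h.red _ (by linarith) (by linarith))
  · intro y h1 h2
    have := h.blue (y - 4) (by linarith) (by linarith)
    rw [← e] at this
    convert this using 3
    ring
  · simpa only [not_not, e] using h.cell0

theorem Bad.shift {P : ℝ → Prop} (hp : Function.Periodic P 8) {x θ : ℝ} (k : ℤ)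
    (h : Bad P x θ) : Bad P (x - k * 8) θ := by
  have e : ∀ i : ℕ, P (x - k * 8 + i * θ) = P (x + i * θ) := by
    intro i
    rw [← hp.sub_int_mul_eq (x := x + i * θ) k]
    congr 1; ring
  refine ⟨fun i hi => ?_, fun i hi hi' => ?_⟩
  · rw [e]; exact h.1 i hi
  · rw [e]; exact h.2 i hi hi'

theorem exists_shift (a y : ℝ) : ∃ k : ℤ, a ≤ y - k * 8 ∧ y - k * 8 < a + 8 := by
  refine ⟨⌊(y - a) / 8⌋, ?_, ?_⟩
  · have := Int.floor_le ((y - a) / 8); linarith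
  · have := Int.lt_floor_add_one ((y - a) / 8); linarith

theorem caseA {n : ℕ} {P : ℝ → Prop} (h : Top (n + 2) P) {x θ : ℝ} (hθ : (3/14 : ℝ) ^ n < θ)
    (h2 : θ ≤ 2) (hB : Bad P x θ) : False := by
  obtain ⟨k, hk1, hk2⟩ := exists_shift (-5) (x + 13 * θ)
  replace hB := hB.shift h.per k
  set X := x - k * 8 with hX
  have hpos : 0 < θ := lt_trans (by positivity) hθ
  have h1 : -5 ≤ X + 13 * θ := by linarith
  have h3 : X + 13 * θ < 3 := by linarith
  clear_value X
  have r13 := hB.1 13 (by norm_num)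
  have b14 := hB.2 14 (by norm_num) (by norm_num)
  push_cast at r13 b14
  have h3' : X + 13 * θ < 1 := by
    by_contra hc
    push Not at hc
    exact h.blue _ hc h3.le r13
  have h1' : -5 < X + 13 * θ := by
    rcases h1.lt_or_eq with g | g
    · exact g
    · exact absurd r13 (h.blue' _ (by linarith) (by linarith))
  have h0 : -5 < X + (0 : ℕ) * θ := by
    refine nojump_down (u := -7) (by linarith) 0 13 (by norm_num) (by push_cast; linarith) ?_
    intro i hi hi' hu hv
    exact h.blue' _ hu hv (hB.1 i (by omega))
  push_cast at h0
  rcases lt_or_ge (X + 14 * θ) (-3) with g | g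
  · have h27 : X + (27 : ℕ) * θ < -3 := by
      refine nojump_up (v := -1) (by linarith) 14 27 (by norm_num) (by push_cast; linarith) ?_
      intro i hi hi' hu hv
      exact hB.2 i hi (by omega) (h.red' _ hu hv)
    push_cast at h27
    have e : ∀ y, P (1 * y + (-4)) ↔ ¬ (fun y => ¬ P (y + 4)) y := by
      intro y
      simp only [not_not]
      rw [← h.per (1 * y + (-4))]
      ring_nf
    refine (core n).2 _ ((X - (-4)) / 1) (θ / 1) h.cell1 (by simpa using hθ)
      (hB.scale 1 (-4) (by norm_num) e) ?_ ?_ <;> linarith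
  · have g' : -1 < X + 14 * θ := by
      by_contra hc
      push Not at hc
      exact b14 (h.red' _ g hc)
    have h27 : X + (27 : ℕ) * θ < 5 := by
      refine nojump_up (v := 7) (by linarith) 14 27 (by norm_num) (by push_cast; linarith) ?_
      intro i hi hi' hu hv
      exact hB.2 i hi (by omega) (h.red _ hu hv)
    push_cast at h27
    exact (core n).1 P X θ h.cell0 hθ hB (by linarith) (by linarith) (by linarith)

theorem caseC {n : ℕ} {P : ℝ → Prop} (h : Top n P) {x θ : ℝ} (hθ : (3/14 : ℝ) ^ n < 4 - θ)
    (h2 : 3 ≤ θ) (hB : ∀ i : ℕ, i < 14 → P (x + i * θ)) : False := by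
  obtain ⟨ε, rfl⟩ : ∃ ε, θ = 4 - ε := ⟨4 - θ, by ring⟩
  rw [sub_sub_cancel] at hθ
  have hpos : 0 < ε := lt_trans (by positivity) hθ
  have hle : ε ≤ 1 := by linarith
  have hev : ∀ j : ℕ, j < 7 → P (x - (2 * j : ℕ) * ε) := by
    intro j hj
    have := hB (2 * j) (by omega)
    rw [← h.per.sub_int_mul_eq (j : ℤ)] at this
    convert this using 1
    push_cast; ring
  have hod : ∀ j : ℕ, j < 7 → P (x - (2 * j + 1 : ℕ) * ε + 4) := by
    intro j hj
    have := hB (2 * j + 1) (by omega)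
    rw [← h.per.sub_int_mul_eq (j : ℤ)] at this
    convert this using 1
    push_cast; ring
  obtain ⟨k, hk1, hk2⟩ := exists_shift (-3) (x - 13 * ε + ε)
  have hA : Alt P (fun y => ¬ P (y + 4)) (x - 13 * ε - k * 8) ε := by
    intro i hi
    have e1 : ∀ a c : ℝ, P (a - k * 8 + c) = P (a + c) := by
      intro a c
      rw [← h.per.sub_int_mul_eq (x := a + c) k]
      congr 1; ring
    have e2 : ∀ a c : ℝ, P (a - k * 8 + c + 4) = P (a + c + 4) := by
      intro a c
      rw [← h.per.sub_int_mul_eq (x := a + c + 4) k]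
      congr 1; ring
    simp only [e1, e2, not_not]
    obtain ⟨j, hj⟩ := Nat.even_or_odd' i
    rcases hj with rfl | rfl
    · right
      have g1 := hod (6 - j) (by omega)
      have g2 := hev (6 - j) (by omega)
      have hc : ((6 - j : ℕ) : ℝ) = 6 - j := by
        rw [Nat.cast_sub (by omega)]; norm_num
      push_cast [hc] at g1 g2 ⊢
      refine ⟨?_, ?_⟩
      · convert g1 using 1; ring
      · convert g2 using 1; ring
    · left
      have g1 := hod (5 - j) (by omega)
      have g2 := hev (6 - j) (by omega)
      have hc : ((6 - j : ℕ) : ℝ) = 6 - j := by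
        rw [Nat.cast_sub (by omega)]; norm_num
      have hc' : ((5 - j : ℕ) : ℝ) = 5 - j := by
        rw [Nat.cast_sub (by omega)]; norm_num
      push_cast [hc, hc'] at g1 g2 ⊢
      refine ⟨?_, ?_⟩
      · convert g2 using 1; ring
      · convert g1 using 1; ring
  set Z := x - 13 * ε - k * 8 with hZ
  have hz1 : -3 ≤ Z + ε := by linarith
  have hz2 : Z + ε < 5 := by linarith
  clear_value Z
  have hT := h.turn
  rcases hA.dich (u := -3) (v := -1) hpos (by linarith)
    (Or.inl fun y a b => ⟨h.red' y a b, hT.red' y a b⟩) with g | g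
  · linarith
  rcases hA.dich (u := 1) (v := 3) hpos (by linarith)
    (Or.inr fun y a b => ⟨h.blue y a b, hT.blue y a b⟩) with g' | g'
  · exact altCore n _ _ _ _ h.cell0 h.cell1 hθ hA g.le g'.le
  rcases hA.dich (u := 5) (v := 7) hpos (by linarith)
    (Or.inl fun y a b => ⟨h.red y a b, hT.red y a b⟩) with g'' | g''
  · refine altCore n _ _ ((Z - 4) / 1) (ε / 1) h.cell0 h.cell1 (by simpa using hθ)
      (hA.neg.scale 1 4 (by norm_num) (fun y => ?_) (fun y => ?_)) ?_ ?_
    · simp only [not_not]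
      rw [one_mul, add_assoc, show (4 : ℝ) + 4 = 8 by norm_num, h.per y]
    · simp only [one_mul]
    · linarith
    · linarith
  · linarith

theorem caseB {n : ℕ} {P : ℝ → Prop} (h : Top n P) {x θ : ℝ} (h2 : 2 ≤ θ) (h3 : θ ≤ 3)
    (hB : Bad P x θ) : False := by
  let R : ℕ → ℝ → Prop := fun i u => (∃ k : ℤ, x + i * θ = u + 3 + k * 8) ∧ 0 < u ∧ u < 6
  let B : ℕ → ℝ → Prop := fun i u => (∃ k : ℤ, x + i * θ = u - 1 + k * 8) ∧ 0 < u ∧ u < 6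
  have pk : ∀ (y : ℝ) (k : ℤ), P (y + k * 8) = P y := by
    intro y k
    rw [← h.per.sub_int_mul_eq (x := y + k * 8) k]
    congr 1; ring
  have nr : ∀ (i : ℕ) (u : ℝ) (k : ℤ), i < 14 → x + i * θ = u + 3 + k * 8 → 6 ≤ u → u ≤ 8 →
      False := by
    intro i u k hi e h6 h8
    have := hB.1 i hi
    rw [e, pk] at this
    have e' := pk (u + 3 - 8) 1
    rw [show u + 3 - 8 + ((1 : ℤ) : ℝ) * 8 = u + 3 by push_cast; ring] at e'
    rw [e'] at this
    exact h.blue _ (by linarith) (by linarith) this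
  have nb : ∀ (i : ℕ) (u : ℝ) (k : ℤ), 14 ≤ i → i < 28 → x + i * θ = u - 1 + k * 8 → 6 ≤ u →
      u ≤ 8 → False := by
    intro i u k hi hi' e h6 h8
    have := hB.2 i hi hi'
    rw [e, pk] at this
    exact this (h.red _ (by linarith) (by linarith))
  have sR : ∀ (i : ℕ) (u : ℝ), i + 1 < 14 → R i u → R (i + 1) (u + θ) ∨ R (i + 1) (u + θ - 8) := by
    rintro i u hi ⟨⟨k, hk⟩, h0, h6⟩
    have e : x + (i + 1 : ℕ) * θ = (u + θ) + 3 + k * 8 := by push_cast; linarith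
    rcases lt_or_ge (u + θ) 6 with g | g
    · exact Or.inl ⟨⟨k, e⟩, by linarith, g⟩
    · rcases lt_or_ge 8 (u + θ) with g' | g'
      · exact Or.inr ⟨⟨k + 1, by rw [e]; push_cast; ring⟩, by linarith, by linarith⟩
      · exact (nr _ _ _ hi e g g').elim
  have sB : ∀ (i : ℕ) (u : ℝ), 14 ≤ i → i + 1 < 28 → B i u →
      B (i + 1) (u + θ) ∨ B (i + 1) (u + θ - 8) := by
    rintro i u hi hi' ⟨⟨k, hk⟩, h0, h6⟩
    have e : x + (i + 1 : ℕ) * θ = (u + θ) - 1 + k * 8 := by push_cast; linarith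
    rcases lt_or_ge (u + θ) 6 with g | g
    · exact Or.inl ⟨⟨k, e⟩, by linarith, g⟩
    · rcases lt_or_ge 8 (u + θ) with g' | g'
      · exact Or.inr ⟨⟨k + 1, by rw [e]; push_cast; ring⟩, by linarith, by linarith⟩
      · exact (nb _ _ _ (by omega) hi' e g g').elim
  have sRB : ∀ u : ℝ, R 13 u → B 14 (u + θ - 4) := by
    rintro u ⟨⟨k, hk⟩, h0, h6⟩
    have e : x + (14 : ℕ) * θ = (u + θ - 4) - 1 + (k + 1 : ℤ) * 8 := by
      push_cast at hk ⊢; linarith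
    have e' : x + (14 : ℕ) * θ = (u + θ + 4) - 1 + k * 8 := by
      push_cast at hk ⊢; linarith
    refine ⟨⟨k + 1, e⟩, ?_, by linarith⟩
    by_contra hc
    push Not at hc
    exact nb 14 _ _ le_rfl (by norm_num) e' (by linarith) (by linarith)
  have h11 : ∃ u, R 11 u := by
    obtain ⟨k, k1, k2⟩ := exists_shift 3 (x + (11 : ℕ) * θ)
    refine ⟨x + (11 : ℕ) * θ - k * 8 - 3, ⟨k, by ring⟩, ?_, ?_⟩
    · by_contra hc
      push Not at hc
      exact nr 11 8 (k - 1) (by norm_num) (by push_cast at hc k1 ⊢; linarith) (by norm_num) le_rfl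
    · by_contra hc
      push Not at hc
      exact nr 11 (x + (11 : ℕ) * θ - k * 8 - 3) k (by norm_num) (by ring) hc (by linarith)
  obtain ⟨u, h11⟩ := h11
  have a11 := h11.2.1
  have b11 := h11.2.2
  rcases sR 11 _ (by norm_num) h11 with h12 | h12
  all_goals
    have a12 := h12.2.1
    have b12 := h12.2.2
    rcases sR 12 _ (by norm_num) h12 with h13 | h13
  all_goals
    have a13 := h13.2.1
    have b13 := h13.2.2
    first
    | (exfalso; linarith)
    | skip
  all_goals
    have h14 := sRB _ h13
    have a14 := h14.2.1
    have b14 := h14.2.2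
    first
    | (exfalso; linarith)
    | skip
  all_goals
    rcases sB 14 _ (by norm_num) (by norm_num) h14 with h15 | h15
  all_goals
    have a15 := h15.2.1
    have b15 := h15.2.2
    first
    | (exfalso; linarith)
    | skip
  all_goals
    rcases sB 15 _ (by norm_num) (by norm_num) h15 with h16 | h16
  all_goals
    have a16 := h16.2.1
    have b16 := h16.2.2
    first
    | (exfalso; linarith)
    | skip
  all_goals
    rcases sB 16 _ (by norm_num) (by norm_num) h16 with h17 | h17
  all_goals
    have a17 := h17.2.1
    have b17 := h17.2.2
    first
    | (exfalso; linarith)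
    | skip
  all_goals
    rcases sB 17 _ (by norm_num) (by norm_num) h17 with h18 | h18
  all_goals
    have a18 := h18.2.1
    have b18 := h18.2.2
    first
    | (exfalso; linarith)
    | skip
  all_goals
    rcases sB 18 _ (by norm_num) (by norm_num) h18 with h19 | h19
  all_goals
    have a19 := h19.2.1
    have b19 := h19.2.2
    first
    | (exfalso; linarith)
    | skip
  all_goals
    rcases sB 19 _ (by norm_num) (by norm_num) h19 with h20 | h20
  all_goals
    have a20 := h20.2.1
    have b20 := h20.2.2
    first
    | (exfalso; linarith)
    | skip
  all_goals
    rcases sB 20 _ (by norm_num) (by norm_num) h20 with h21 | h21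
  all_goals
    have a21 := h21.2.1
    have b21 := h21.2.2
    first
    | (exfalso; linarith)
    | skip

theorem Top.noBad {n : ℕ} {P : ℝ → Prop} (h : Top (n + 2) P) {x θ : ℝ}
    (h1 : (3/14 : ℝ) ^ n < θ) (h2 : (3/14 : ℝ) ^ n < 4 - θ) (hB : Bad P x θ) : False := by
  rcases le_total θ 2 with g | g
  · exact caseA h h1 g hB
  rcases le_total θ 3 with g' | g'
  · exact caseB h g g' hB
  · refine caseC h (lt_of_le_of_lt ?_ h2) g' hB.1
    exact pow_le_pow_of_le_one (by norm_num) (by norm_num) (by omega)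

/-- The self-similar colouring of a cell, with default colour `D`. -/
def col : ℕ → Prop → ℝ → Prop
  | 0, D, _ => D
  | n + 1, D, y =>
    (y < -(4/7) ∧ col n D ((y - -(11/14)) / (3/14))) ∨
    (-(1/7) < y ∧ y < 1/7 ∧ ¬ col n D (y / (1/7))) ∨
    (1/7 ≤ y ∧ y ≤ 4/7) ∨
    (4/7 < y ∧ col n D ((y - 11/14) / (3/14)))

set_option maxHeartbeats 2000000 in
theorem col_neg (n : ℕ) : ∀ (D : Prop) (y : ℝ), col n (¬ D) (-y) ↔ ¬ col n D y := by
  induction n with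
  | zero => intro D y; exact Iff.rfl
  | succ n ih =>
    intro D y
    have e1 := ih D ((y - -(11/14)) / (3/14))
    have e2 := ih D (y / (1/7))
    have e3 := ih D ((y - 11/14) / (3/14))
    rw [show -((y - -(11/14)) / (3/14)) = (-y - 11/14) / (3/14) by ring] at e1
    rw [show -(y / (1/7)) = (-y) / (1/7) by ring] at e2
    rw [show -((y - 11/14) / (3/14)) = (-y - -(11/14)) / (3/14) by ring] at e3
    simp only [col]
    rw [e1, e2, e3]
    clear e1 e2 e3 ih
    rcases lt_or_ge y (-(4/7)) with g | g
    · have c1 : ¬ (-y < -(4/7)) := by linarith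
      have c2 : ¬ (-y < 1/7) := by linarith
      have c3 : ¬ (-y ≤ 4/7) := by linarith
      have c4 : 4/7 < -y := by linarith
      have c5 : ¬ (-(1/7) < y) := by linarith
      have c6 : ¬ (1/7 ≤ y) := by linarith
      have c7 : ¬ (4/7 < y) := by linarith
      tauto
    rcases le_or_gt y (-(1/7)) with g' | g'
    · have c1 : ¬ (y < -(4/7)) := by linarith
      have c2 : ¬ (-(1/7) < y) := by linarith
      have c3 : ¬ (1/7 ≤ y) := by linarith
      have c4 : ¬ (4/7 < y) := by linarith
      have c5 : 1/7 ≤ -y := by linarith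
      have c6 : -y ≤ 4/7 := by linarith
      tauto
    rcases lt_or_ge y (1/7) with g2 | g2
    · have c1 : ¬ (y < -(4/7)) := by linarith
      have c3 : ¬ (1/7 ≤ y) := by linarith
      have c4 : ¬ (4/7 < y) := by linarith
      have d1 : ¬ (-y < -(4/7)) := by linarith
      have d3 : ¬ (1/7 ≤ -y) := by linarith
      have d4 : ¬ (4/7 < -y) := by linarith
      have d5 : -(1/7) < -y := by linarith
      have d6 : -y < 1/7 := by linarith
      tauto
    rcases le_or_gt y (4/7) with g3 | g3
    · have d1 : ¬ (-y < -(4/7)) := by linarith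
      have d3 : ¬ (1/7 ≤ -y) := by linarith
      have d4 : ¬ (4/7 < -y) := by linarith
      have d5 : ¬ (-(1/7) < -y) := by linarith
      tauto
    · have c1 : ¬ (y < -(4/7)) := by linarith
      have c2 : ¬ (y < 1/7) := by linarith
      have c3 : ¬ (y ≤ 4/7) := by linarith
      have d1 : -y < -(4/7) := by linarith
      have d3 : ¬ (1/7 ≤ -y) := by linarith
      have d4 : ¬ (4/7 < -y) := by linarith
      have d5 : ¬ (-(1/7) < -y) := by linarith
      tauto

set_option maxHeartbeats 2000000 in
theorem cell_of_col (n : ℕ) : ∀ P : ℝ → Prop,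
    (∀ y, -1 < y → y < 1 → ∃ D, (P y ↔ col n D y)) → Cell n P := by
  induction n with
  | zero => intro P _; trivial
  | succ n ih =>
    intro P h
    refine ⟨?_, ?_, ih _ ?_, ih _ ?_, ih _ ?_⟩
    · intro y h1 h2
      obtain ⟨D, hD⟩ := h y (by linarith) (by linarith)
      rw [hD]
      exact Or.inr (Or.inr (Or.inl ⟨h1, h2⟩))
    · intro y h1 h2
      obtain ⟨D, hD⟩ := h y (by linarith) (by linarith)
      rw [hD]
      rintro (g | g | g | g)
      · linarith [g.1]
      · linarith [g.1]
      · linarith [g.1]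
      · linarith [g.1]
    · intro y h1 h2
      obtain ⟨D, hD⟩ := h (1/7 * y + 0) (by linarith) (by linarith)
      refine ⟨D, ?_⟩
      rw [hD]
      simp only [col]
      have c1 : ¬ (1/7 * y + 0 < -(4/7)) := by linarith
      have c3 : ¬ (1/7 ≤ 1/7 * y + 0) := by linarith
      have c4 : ¬ (4/7 < 1/7 * y + 0) := by linarith
      have c5 : -(1/7) < 1/7 * y + 0 := by linarith
      have c6 : 1/7 * y + 0 < 1/7 := by linarith
      rw [show (1/7 * y + 0) / (1/7) = y by ring]
      tauto
    · intro y h1 h2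
      obtain ⟨D, hD⟩ := h (3/14 * y + 11/14) (by linarith) (by linarith)
      refine ⟨D, ?_⟩
      rw [hD]
      simp only [col]
      have c1 : ¬ (3/14 * y + 11/14 < -(4/7)) := by linarith
      have c3 : ¬ (3/14 * y + 11/14 < 1/7) := by linarith
      have c4 : ¬ (3/14 * y + 11/14 ≤ 4/7) := by linarith
      have c5 : 4/7 < 3/14 * y + 11/14 := by linarith
      rw [show (3/14 * y + 11/14 - 11/14) / (3/14) = y by ring]
      tauto
    · intro y h1 h2
      obtain ⟨D, hD⟩ := h (3/14 * y + -(11/14)) (by linarith) (by linarith)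
      refine ⟨D, ?_⟩
      rw [hD]
      simp only [col]
      have c1 : 3/14 * y + -(11/14) < -(4/7) := by linarith
      have c3 : ¬ (-(1/7) < 3/14 * y + -(11/14)) := by linarith
      have c4 : ¬ (1/7 ≤ 3/14 * y + -(11/14)) := by linarith
      have c5 : ¬ (4/7 < 3/14 * y + -(11/14)) := by linarith
      rw [show (3/14 * y + -(11/14) - -(11/14)) / (3/14) = y by ring]
      tauto

/-- The colouring on the fundamental domain `[-4,4)`. -/
def base (n : ℕ) (y : ℝ) : Prop :=
  (-3 ≤ y ∧ y ≤ -1) ∨ (-1 < y ∧ y < 1 ∧ col n (y < 0) y) ∨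
  (3 < y ∧ ¬ col n (y < 0) (y - 4)) ∨ (y < -3 ∧ ¬ col n (y < 0) (y + 4))

set_option maxHeartbeats 2000000 in
theorem base_neg (n : ℕ) (y : ℝ) (hy : y ≠ 0) : base n (-y) ↔ ¬ base n y := by
  have e0 : (-y < 0) = ¬ (y < 0) := by
    apply propext
    rw [neg_lt_zero, not_lt]
    exact ⟨fun h => h.le, fun h => lt_of_le_of_ne h (Ne.symm hy)⟩
  have e1 := col_neg n (y < 0) y
  have e2 := col_neg n (y < 0) (y - 4)
  have e3 := col_neg n (y < 0) (y + 4)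
  rw [show -(y - 4) = -y + 4 by ring] at e2
  rw [show -(y + 4) = -y - 4 by ring] at e3
  unfold base
  rw [e0, e1, e2, e3]
  clear e0 e1 e2 e3 hy
  rcases lt_or_ge y (-3) with g | g
  · have c1 : ¬ (-3 ≤ y) := by linarith
    have c2 : ¬ (-1 < y) := by linarith
    have c3 : ¬ (3 < y) := by linarith
    have c4 : ¬ (-3 ≤ -y ∧ -y ≤ -1) := by rintro ⟨_, _⟩; linarith
    have c5 : ¬ (-y < 1) := by linarith
    have c6 : ¬ (-y < -3) := by linarith
    have c7 : 3 < -y := by linarith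
    tauto
  rcases le_or_gt y (-1) with g1 | g1
  · have c4 : ¬ (-3 ≤ -y ∧ -y ≤ -1) := by rintro ⟨_, _⟩; linarith
    have c5 : ¬ (-y < 1) := by linarith
    have c6 : ¬ (-y < -3) := by linarith
    have c7 : ¬ (3 < -y) := by linarith
    tauto
  rcases lt_or_ge y 1 with g2 | g2
  · have c1 : ¬ (y ≤ -1) := by linarith
    have c2 : ¬ (y < -3) := by linarith
    have c3 : ¬ (3 < y) := by linarith
    have c4 : ¬ (-y ≤ -1) := by linarith
    have c5 : -y < 1 := by linarith
    have c6 : -1 < -y := by linarith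
    have c7 : ¬ (3 < -y) := by linarith
    have c8 : ¬ (-y < -3) := by linarith
    tauto
  rcases le_or_gt y 3 with g3 | g3
  · have c1 : ¬ (y ≤ -1) := by linarith
    have c2 : ¬ (y < -3) := by linarith
    have c3 : ¬ (3 < y) := by linarith
    have c0 : ¬ (y < 1) := by linarith
    have c4 : -3 ≤ -y := by linarith
    have c5 : -y ≤ -1 := by linarith
    tauto
  · have c1 : ¬ (y ≤ -1) := by linarith
    have c2 : ¬ (y < -3) := by linarith
    have c0 : ¬ (y < 1) := by linarith
    have c4 : ¬ (-3 ≤ -y) := by linarith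
    have c5 : ¬ (-1 < -y) := by linarith
    have c6 : ¬ (3 < -y) := by linarith
    have c7 : -y < -3 := by linarith
    tauto

theorem exists_top (n : ℕ) : ∃ P : ℝ → Prop, Top n P ∧
    ∀ y, -4 < y → y < 4 → y ≠ 0 → (P (-y) ↔ ¬ P y) := by
  have fl : ∀ (y : ℝ) (k : ℤ), -4 ≤ y - k * 8 → y - k * 8 < 4 → ⌊(y + 4) / 8⌋ = k := by
    intro y k h1 h2
    rw [Int.floor_eq_iff]
    constructor <;> linarith
  let P : ℝ → Prop := fun y => base n (y - ⌊(y + 4) / 8⌋ * 8)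
  have P0 : ∀ y, -4 ≤ y → y < 4 → (P y ↔ base n y) := by
    intro y h1 h2
    show base n (y - ⌊(y + 4) / 8⌋ * 8) ↔ _
    rw [fl y 0 (by push_cast; linarith) (by push_cast; linarith)]
    simp
  have per : Function.Periodic P 8 := by
    intro y
    show base n (y + 8 - ⌊(y + 8 + 4) / 8⌋ * 8) = base n (y - ⌊(y + 4) / 8⌋ * 8)
    rw [show (y + 8 + 4) / 8 = (y + 4) / 8 + 1 by ring, Int.floor_add_one]
    congr 1
    push_cast
    ring
  refine ⟨P, ⟨per, ?_, ?_, ?_, ?_⟩, ?_⟩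
  · intro y h1 h2
    rw [P0 y (by linarith) (by linarith)]
    rintro (g | g | g | g)
    · linarith [g.1]
    · linarith [g.2.1]
    · linarith [g.1]
    · linarith [g.1]
  · intro y h1 h2
    rw [← sub_add_cancel y 8, per, P0 _ (by linarith) (by linarith)]
    exact Or.inl ⟨by linarith, by linarith⟩
  · refine cell_of_col n _ ?_
    intro y h1 h2
    refine ⟨y < 0, ?_⟩
    rw [P0 y (by linarith) (by linarith)]
    unfold base
    have c1 : ¬ (y ≤ -1) := by linarith
    have c2 : ¬ (y < -3) := by linarith
    have c3 : ¬ (3 < y) := by linarith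
    tauto
  · refine cell_of_col n _ ?_
    intro y h1 h2
    rcases lt_or_ge y 0 with g | g
    · refine ⟨y + 4 < 0, ?_⟩
      rw [P0 (y + 4) (by linarith) (by linarith)]
      unfold base
      have c1 : ¬ (y + 4 ≤ -1) := by linarith
      have c2 : ¬ (y + 4 < 1) := by linarith
      have c3 : 3 < y + 4 := by linarith
      have c4 : ¬ (y + 4 < -3) := by linarith
      rw [add_sub_cancel_right]
      tauto
    · refine ⟨y - 4 < 0, ?_⟩
      rw [show y + 4 = (y - 4) + 8 by ring, per, P0 (y - 4) (by linarith) (by linarith)]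
      unfold base
      have c1 : ¬ (-3 ≤ y - 4) := by linarith
      have c2 : ¬ (-1 < y - 4) := by linarith
      have c3 : ¬ (3 < y - 4) := by linarith
      have c4 : y - 4 < -3 := by linarith
      rw [sub_add_cancel]
      tauto
  · intro y h1 h2 h0
    rw [P0 y h1.le h2, P0 (-y) (by linarith) (by linarith)]
    exact base_neg n y h0

theorem exists_colouring (p : ℕ) (hp : p.Prime) (h2 : 2 < p) : ∃ A : Set (ZMod p),
    (∀ x : ZMod p, x ≠ 0 → (-x ∈ A ↔ x ∉ A)) ∧ ¬ HasAP A 14 14 := by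
  have : Fact p.Prime := ⟨hp⟩
  have hodd : p % 2 = 1 := by
    rcases hp.eq_two_or_odd with h | h
    · omega
    · exact h
  have hp0 : (0 : ℝ) < p := by exact_mod_cast hp.pos
  obtain ⟨n, hn⟩ : ∃ n : ℕ, (3/14 : ℝ) ^ n < 1 / p :=
    exists_pow_lt_of_lt_one (by positivity) (by norm_num)
  obtain ⟨P, hT, hneg⟩ := exists_top (n + 2)
  have habs : ∀ x : ZMod p, 2 * x.valMinAbs < p ∧ -(p : ℤ) < 2 * x.valMinAbs := by
    intro x
    have := ZMod.valMinAbs_mem_Ioc x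
    rw [Set.mem_Ioc] at this
    omega
  have habs' : ∀ x : ZMod p, 2 * (x.valMinAbs : ℝ) + 1 ≤ p ∧ -(p : ℝ) + 1 ≤ 2 * x.valMinAbs := by
    intro x
    obtain ⟨h1, h2⟩ := habs x
    constructor
    · exact_mod_cast (by omega : 2 * x.valMinAbs + 1 ≤ (p : ℤ))
    · exact_mod_cast (by omega : -(p : ℤ) + 1 ≤ 2 * x.valMinAbs)
  let A : Set (ZMod p) := {x | P (8 * (x.valMinAbs : ℝ) / p)}
  have key : ∀ k : ℤ, ((k : ZMod p) ∈ A ↔ P (8 * (k : ℝ) / p)) := by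
    intro k
    show P (8 * (((k : ZMod p).valMinAbs : ℤ) : ℝ) / p) ↔ _
    have hc : (((k : ZMod p).valMinAbs : ℤ) : ZMod p) = (k : ZMod p) := ZMod.coe_valMinAbs _
    rw [ZMod.intCast_eq_intCast_iff_dvd_sub] at hc
    obtain ⟨j, hj⟩ := hc
    have hj' : (k : ℝ) = ((k : ZMod p).valMinAbs : ℤ) + p * j := by
      have : k = (k : ZMod p).valMinAbs + p * j := by linarith
      exact_mod_cast this
    rw [← hT.per.sub_int_mul_eq (x := 8 * (k : ℝ) / p) j]
    rw [show 8 * (k : ℝ) / p - j * 8 = 8 * (((k : ZMod p).valMinAbs : ℤ) : ℝ) / p by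
      rw [eq_comm]
      field_simp
      linarith]
  refine ⟨A, ?_, ?_⟩
  · intro x hx
    have h1 := key (-x.valMinAbs)
    have h2 := key x.valMinAbs
    push_cast at h1 h2
    rw [h1, h2, show 8 * -(x.valMinAbs : ℝ) / p = -(8 * (x.valMinAbs : ℝ) / p) by ring]
    obtain ⟨a1, a2⟩ := habs' x
    apply hneg
    · rw [lt_div_iff₀ hp0]; linarith
    · rw [div_lt_iff₀ hp0]; linarith
    · have : (x.valMinAbs : ℝ) ≠ 0 := by
        have : x.valMinAbs ≠ 0 := by rwa [Ne, ZMod.valMinAbs_eq_zero]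
        exact_mod_cast this
      positivity
  · rintro ⟨x, d, hd, hr, hb⟩
    set X : ℝ := 8 * (x.valMinAbs : ℝ) / p with hX
    set θ : ℝ := 8 * (d.valMinAbs : ℝ) / p with hθ
    have mem : ∀ i : ℕ, (x + (i : ZMod p) * d ∈ A ↔ P (X + i * θ)) := by
      intro i
      have := key (x.valMinAbs + i * d.valMinAbs)
      push_cast at this
      rw [this, hX, hθ]
      rw [show 8 * ((x.valMinAbs : ℝ) + i * (d.valMinAbs : ℝ)) / p =
        8 * (x.valMinAbs : ℝ) / p + i * (8 * (d.valMinAbs : ℝ) / p) by ring]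
    have hB : Bad P X θ :=
      ⟨fun i hi => (mem i).1 (hr i hi), fun i hi hi' h => hb i hi hi' ((mem i).2 h)⟩
    obtain ⟨a1, a2⟩ := habs' d
    have hd0 : d.valMinAbs ≠ 0 := by rwa [Ne, ZMod.valMinAbs_eq_zero]
    rcases lt_or_gt_of_ne hd0 with g | g
    · have g' : (d.valMinAbs : ℝ) ≤ -1 := by exact_mod_cast (by omega : d.valMinAbs ≤ -1)
      have hB' : Bad (fun y => P (4 - y)) (4 - X) (-θ) := by
        have e : ∀ i : ℕ, 4 - (4 - X + i * -θ) = X + i * θ := by intro i; ring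
        refine ⟨fun i hi => ?_, fun i hi hi' => ?_⟩
        · show P _
          rw [e]; exact hB.1 i hi
        · show ¬ P _
          rw [e]; exact hB.2 i hi hi'
      refine hT.reflect.noBad (hn.trans_le ?_) (hn.trans_le ?_) hB'
      · rw [div_le_iff₀ hp0, hθ, neg_mul, div_mul_cancel₀ _ hp0.ne']; linarith
      · rw [div_le_iff₀ hp0, hθ, sub_neg_eq_add, add_mul, div_mul_cancel₀ _ hp0.ne']; linarith
    · have g' : 1 ≤ (d.valMinAbs : ℝ) := by exact_mod_cast (by omega : 1 ≤ d.valMinAbs)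
      refine hT.noBad (hn.trans_le ?_) (hn.trans_le ?_) hB
      · rw [div_le_iff₀ hp0, hθ, div_mul_cancel₀ _ hp0.ne']; linarith
      · rw [div_le_iff₀ hp0, hθ, sub_mul, div_mul_cancel₀ _ hp0.ne']; linarith

theorem card_bound (p : ℕ) (hp : p.Prime) (A : Set (ZMod p))
    (h : ∀ x : ZMod p, x ≠ 0 → (-x ∈ A ↔ x ∉ A)) :
    p ≤ 2 * Nat.card ↥A + 1 := by
  have : Fact p.Prime := ⟨hp⟩
  have hc : A.ncard + Aᶜ.ncard = p := by
    rw [Set.ncard_add_ncard_compl, Nat.card_zmod]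
  have hle : Aᶜ.ncard ≤ (insert 0 (Neg.neg '' A)).ncard := by
    apply Set.ncard_le_ncard _ (Set.toFinite _)
    intro x hx
    by_cases h0 : x = 0
    · exact Or.inl h0
    · exact Or.inr ⟨-x, (h x h0).2 hx, neg_neg x⟩
  have h1 : (insert 0 (Neg.neg '' A)).ncard ≤ (Neg.neg '' A).ncard + 1 := Set.ncard_insert_le _ _
  have h2 : (Neg.neg '' A).ncard ≤ A.ncard := Set.ncard_image_le (Set.toFinite _)
  rw [Nat.card_coe_set_eq]
  omega

theorem main_colouring : ∀ δ : ℝ, δ < 1 / 2 → ∃ p₁ : ℕ, ∀ p : ℕ, p.Prime → p₁ ≤ p →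
      ∃ A : Set (ZMod p),
        δ * p ≤ Nat.card ↥A ∧ δ * p ≤ Nat.card ↥(Aᶜ) ∧ ¬ HasAP A 14 14 := by
  intro δ hδ
  obtain ⟨N, hN⟩ := exists_nat_gt (1 / (1 - 2 * δ))
  refine ⟨max N 3, fun p hp hpN => ?_⟩
  obtain ⟨A, hA, hAP⟩ := exists_colouring p hp (by omega)
  have hNp : (N : ℝ) ≤ p := by exact_mod_cast (le_max_left N 3).trans hpN
  have hpos : 0 < 1 - 2 * δ := by linarith
  have h1 : 1 ≤ p * (1 - 2 * δ) := by
    rw [div_lt_iff₀ hpos] at hN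
    nlinarith
  have b1 := card_bound p hp A hA
  have b2 := card_bound p hp Aᶜ (by
    intro x hx
    have := hA x hx
    simp only [Set.mem_compl_iff]
    tauto)
  refine ⟨A, ?_, ?_, hAP⟩
  · have : (p : ℝ) ≤ 2 * (Nat.card ↥A : ℝ) + 1 := by exact_mod_cast b1
    linarith
  · have : (p : ℝ) ≤ 2 * (Nat.card ↥(Aᶜ) : ℝ) + 1 := by exact_mod_cast b2
    linarith

end FourteenAP

/-- For every real δ < 1/2 there exists p₁ such that for every prime
p ≥ p₁ there is a red–blue colouring of ℤ/pℤ in which each colour class has at least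
δ·p elements and which contains no (14,14)-AP. In particular (14,14) is not findable. -/
theorem statement3 :
    (∀ δ : ℝ, δ < 1 / 2 → ∃ p₁ : ℕ, ∀ p : ℕ, p.Prime → p₁ ≤ p →
      ∃ A : Set (ZMod p),
        δ * p ≤ Nat.card ↥A ∧ δ * p ≤ Nat.card ↥(Aᶜ) ∧ ¬ HasAP A 14 14) ∧
    ¬ Findable 14 14 := by
  refine ⟨FourteenAP.main_colouring, ?_⟩
  intro hF
  obtain ⟨p₀, h₀⟩ := hF (1/4) (by norm_num)
  obtain ⟨p₁, h₁⟩ := FourteenAP.main_colouring (1/4) (by norm_num)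
  obtain ⟨p, hle, hp⟩ := Nat.exists_infinite_primes (max p₀ p₁)
  obtain ⟨A, a1, a2, a3⟩ := h₁ p hp ((le_max_right _ _).trans hle)
  exact a3 (h₀ p hp ((le_max_left _ _).trans hle) A a1 a2)
end

section
/- For every real δ < 2/95 there exists p₁ such that for every prime p ≥ p₁ there is a red–blue colouring of ℤ/pℤ in which each colour class has at least δ·p elements and which contains no (3,30000)-AP. In particular, the pair (3, 30000) is not findable. -/
namespace FP

/-- Positions of the lacunary gaps. -/
noncomputable def m (k : ℕ) : ℝ := (1/8) * (20/29)^k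

/-- The (fractal) red set inside the unit interval. -/
inductive S : ℝ → Prop
  | core (x : ℝ) (h1 : 31/240 < x) (h2 : x < 209/240) : S x
  | left (k : ℕ) (y x : ℝ) (hy : S y) (hx : x = m k * (1 + y/30)) : S x
  | right (k : ℕ) (y x : ℝ) (hy : S y) (hx : x = 1 - m k * (1 + (1-y)/30)) : S x

lemma m_pos (k : ℕ) : 0 < m k := by unfold m; positivity

lemma m_succ (k : ℕ) : m (k+1) = 20/29 * m k := by unfold m; ring

lemma m_zero : m 0 = 1/8 := by unfold m; norm_num

lemma m_le_of_lt {j k : ℕ} (h : j < k) : m k ≤ 20/29 * m j := by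
  induction k, h using Nat.le_induction with
  | base => exact (m_succ j).le
  | succ n hn ih => rw [m_succ]; have := m_pos n; linarith

lemma m_le (k : ℕ) : m k ≤ 1/8 := by
  rcases Nat.eq_zero_or_pos k with rfl | h
  · exact m_zero.le
  · have := m_le_of_lt h; rw [m_zero] at this; linarith

lemma m_sep {j k : ℕ} (h1 : m j < m k * (31/30)) (h2 : m k < m j * (31/30)) : j = k := by
  have hj := m_pos j
  have hk := m_pos k
  rcases lt_trichotomy j k with h | h | h
  · have := m_le_of_lt h; linarith
  · exact h
  · have := m_le_of_lt h; linarith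

lemma S_pos {x : ℝ} (h : S x) : 0 < x ∧ x < 1 := by
  induction h with
  | core x h1 h2 => constructor <;> linarith
  | left k y x hy hx ih =>
    have := m_pos k
    have := m_le k
    subst hx
    constructor <;> nlinarith
  | right k y x hy hx ih =>
    have := m_pos k
    have := m_le k
    subst hx
    constructor <;> nlinarith

lemma S_symm {x : ℝ} (h : S x) : S (1 - x) := by
  induction h with
  | core x h1 h2 => exact S.core _ (by linarith) (by linarith)
  | left k y x hy hx ih => exact S.right k (1-y) _ ih (by rw [hx]; ring)
  | right k y x hy hx ih => exact S.left k (1-y) _ ih (by rw [hx]; ring)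

lemma left_loc {z : ℝ} (h : S z) (hz : z ≤ 31/240) :
    ∃ k y, S y ∧ z = m k * (1 + y/30) ∧ m k < z ∧ z < m k * (31/30) := by
  cases h with
  | core _ h1 h2 => linarith
  | left k y _ hy hx =>
    have := m_pos k
    obtain ⟨h0, h1⟩ := S_pos hy
    exact ⟨k, y, hy, hx, by rw [hx]; nlinarith, by rw [hx]; nlinarith⟩
  | right k y _ hy hx =>
    exfalso
    have := m_pos k
    have := m_le k
    obtain ⟨h0, h1⟩ := S_pos hy
    nlinarith

lemma left_inv {z : ℝ} (k : ℕ) (h : S z) (h1 : m k < z) (h2 : z < m k * (31/30)) :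
    S ((z / m k - 1) * 30) := by
  have hk := m_pos k
  have hk' := m_le k
  obtain ⟨j, y, hy, hz, h3, h4⟩ := left_loc h (by linarith)
  have : j = k := m_sep (by linarith) (by linarith)
  subst this
  have : (z / m j - 1) * 30 = y := by rw [hz]; field_simp; ring
  rwa [this]

lemma right_inv {z : ℝ} (k : ℕ) (h : S z) (h1 : 1 - m k * (31/30) < z) (h2 : z < 1 - m k) :
    S (1 - ((1 - z) / m k - 1) * 30) :=
  S_symm (left_inv k (S_symm h) (by linarith) (by linarith))

lemma hit {x d u v : ℝ} (hd : 0 < d) (huv : u + d < v) (hx : v ≤ x) (hN : x - u ≤ 30000 * d) :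
    ∃ i : ℕ, 1 ≤ i ∧ i ≤ 30000 ∧ u < x - i * d ∧ x - i * d < v := by
  refine ⟨⌊(x - v)/d⌋₊ + 1, by omega, ?_, ?_, ?_⟩
  all_goals
    have h0 : 0 ≤ (x - v)/d := div_nonneg (by linarith) hd.le
    have h1 := Nat.floor_le h0
    have h2 := Nat.lt_floor_add_one ((x - v)/d)
    rw [le_div_iff₀ hd] at h1
    rw [div_lt_iff₀ hd] at h2
  · have : ((⌊(x - v)/d⌋₊ : ℕ) : ℝ) < (30000 : ℕ) := by
      push_cast
      nlinarith
    have := Nat.cast_lt.mp this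
    omega
  · push_cast; nlinarith
  · push_cast; nlinarith

lemma scale {d : ℝ} (hd : 0 < d) (h : d < 89/28800) :
    ∃ j, d < m j * (89/3600) ∧ m j * (89/3600) ≤ 29/20 * d := by
  have ex : ∃ j, m j * (89/3600) ≤ d := by
    obtain ⟨n, hn⟩ := exists_pow_lt_of_lt_one hd (show (20/29 : ℝ) < 1 by norm_num)
    refine ⟨n, ?_⟩
    unfold m
    have : (0:ℝ) < (20/29)^n := by positivity
    linarith
  classical
  have hs := Nat.find_spec ex
  rcases hf : Nat.find ex with _ | j
  · rw [hf, m_zero] at hs; linarith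
  · refine ⟨j, ?_, ?_⟩
    · have := Nat.find_min ex (m := j) (by omega)
      linarith
    · rw [hf, m_succ] at hs; linarith

lemma left_core (j : ℕ) {x : ℝ} (h1 : m j * (1 + 31/7200) < x) (h2 : x < m j * (1 + 209/7200)) :
    S x := by
  have hj := m_pos j
  refine S.left j ((x / m j - 1) * 30) x (S.core _ ?_ ?_) (by field_simp; ring)
  · have : 1 + 31/7200 < x / m j := by rw [lt_div_iff₀ hj]; linarith
    linarith
  · have : x / m j < 1 + 209/7200 := by rw [div_lt_iff₀ hj]; linarith
    linarith

lemma right_core (j : ℕ) {x : ℝ} (h1 : 1 - m j * (1 + 209/7200) < x)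
    (h2 : x < 1 - m j * (1 + 31/7200)) : S x := by
  have := S_symm (left_core j (x := 1 - x) (by linarith) (by linarith))
  rwa [sub_sub_cancel] at this

/-- Just right of the right end, moving left, one meets the red set quickly. -/
lemma right_catch {x d : ℝ} (hd : 0 < d) (hc : d ≤ 1/550) (h1 : 1 ≤ x) (h2 : x ≤ 1 + d) :
    ∃ i : ℕ, 1 ≤ i ∧ i ≤ 30000 ∧ S (x - i * d) := by
  obtain ⟨j, h3, h4⟩ := scale hd (by linarith)
  have hj := m_pos j
  obtain ⟨i, hi, hi', h5, h6⟩ := hit (x := x) (u := 1 - m j * (1 + 209/7200))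
    (v := 1 - m j * (1 + 31/7200)) hd (by linarith) (by linarith) (by linarith)
  exact ⟨i, hi, hi', right_core j h5 h6⟩

/-- No three-term progression across the left gaps at the critical scale. -/
lemma left_crit {k : ℕ} {x d : ℝ} (hd : m k * (89/3600) * (20/29) ≤ d) (hc : d ≤ 1/550)
    (h1 : m k < x) (h2 : x < m k * (31/30)) (hz1 : S (x + d)) (hz2 : S (x + 2 * d)) : False := by
  have hk := m_pos k
  obtain ⟨i, y, -, -, h3, h4⟩ := left_loc hz1 (by linarith)
  obtain ⟨j, y', -, -, h5, h6⟩ := left_loc hz2 (by linarith)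
  have hi := m_pos i
  have hj := m_pos j
  rcases lt_trichotomy i j with h | h | h
  · have := m_le_of_lt h; linarith
  · subst h
    rcases lt_trichotomy i k with h | h | h
    · have := m_le_of_lt h; linarith
    · subst h; linarith
    · have := m_le_of_lt h; linarith
  · -- `m j ≥ ρ m i`
    obtain rfl | h' : i = j + 1 ∨ j + 1 < i := by omega
    · have e := m_succ j
      rcases lt_trichotomy (j+1) k with h | h | h
      · obtain rfl | h'' : k = j + 1 + 1 ∨ j + 1 + 1 < k := by omega
        · have e' := m_succ (j+1)
          linarith
        · have e' := m_succ (j+1)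
          have := m_le_of_lt h''
          linarith
      · subst h; linarith
      · have := m_le_of_lt h; linarith
    · have e := m_succ j
      have := m_le_of_lt h'
      linarith

lemma main {x : ℝ} (hx : S x) : ∀ d : ℝ, 0 < d → d ≤ 1/550 →
    (∀ i : ℕ, 1 ≤ i → i ≤ 30000 → ¬ S (x - i * d)) →
    (x + d < 1 → S (x + d)) → (x + 2 * d < 1 → S (x + 2 * d)) → False := by
  induction hx with
  | core x h1 h2 =>
    intro d hd hc hb _ _
    by_cases h3 : 31/240 < x - d
    · exact hb 1 le_rfl (by norm_num) (by push_cast; exact S.core _ (by linarith) (by linarith))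
    · by_cases h4 : d * 240 ≤ 1/550
      · obtain ⟨i, hi, hi', h⟩ := right_catch (x := (x / m 0 - 1) * 30) (d := d * 240)
          (by linarith) h4 (by rw [m_zero]; linarith) (by rw [m_zero]; linarith)
        refine hb i hi hi' (S.left 0 _ _ h ?_)
        rw [m_zero]; ring
      · have e : m 1 = 20/29 * (1/8) := by rw [m_succ, m_zero]
        obtain ⟨i, hi, hi', h5, h6⟩ := hit (x := x) (u := m 1 * (1 + 31/7200))
          (v := m 1 * (1 + 209/7200)) hd (by rw [e]; linarith) (by rw [e]; linarith)
          (by rw [e]; linarith)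
        exact hb i hi hi' (left_core 1 h5 h6)
  | left k y x hy hx ih =>
    intro d hd hc hb hz1 hz2
    have hk := m_pos k
    have hk' := m_le k
    obtain ⟨hy0, hy1⟩ := S_pos hy
    have hx1 : m k < x := by rw [hx]; nlinarith
    have hx2 : x < m k * (31/30) := by rw [hx]; nlinarith
    have key : ∀ t : ℝ, ((x + t) / m k - 1) * 30 = y + t * 30 / m k := by
      intro t; rw [hx]; field_simp; ring
    by_cases h4 : d * 30 / m k ≤ 1/550
    · have hd' : 0 < d * 30 / m k := by positivity
      refine ih _ hd' h4 ?_ ?_ ?_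
      · intro i hi hi' h
        refine hb i hi hi' (S.left k _ _ h ?_)
        rw [hx]; field_simp; ring
      · intro h
        rw [← key] at h ⊢
        have h' : (x + d) / m k < 31/30 := by linarith
        rw [div_lt_iff₀ hk] at h'
        exact left_inv k (hz1 (by linarith)) (by linarith) (by linarith)
      · intro h
        have e : y + 2 * (d * 30 / m k) = y + (2 * d) * 30 / m k := by ring
        rw [e, ← key] at h ⊢
        have h' : (x + 2 * d) / m k < 31/30 := by linarith
        rw [div_lt_iff₀ hk] at h'
        exact left_inv k (hz2 (by linarith)) (by linarith) (by linarith)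
    · rw [not_le, lt_div_iff₀ hk] at h4
      by_cases h5 : m k * (89/3600) * (20/29) ≤ d
      · exact left_crit h5 hc hx1 hx2 (hz1 (by linarith)) (hz2 (by linarith))
      · have e := m_succ k
        obtain ⟨i, hi, hi', h5, h6⟩ := hit (x := x) (u := m (k+1) * (1 + 31/7200))
          (v := m (k+1) * (1 + 209/7200)) hd (by rw [e]; linarith) (by rw [e]; linarith)
          (by rw [e]; linarith)
        exact hb i hi hi' (left_core (k+1) h5 h6)
  | right k y x hy hx ih =>
    intro d hd hc hb hz1 hz2
    have hk := m_pos k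
    have hk' := m_le k
    obtain ⟨hy0, hy1⟩ := S_pos hy
    have hx1 : 1 - m k * (31/30) < x := by rw [hx]; nlinarith
    have hx2 : x < 1 - m k := by rw [hx]; nlinarith
    have key : ∀ t : ℝ, 1 - ((1 - (x + t)) / m k - 1) * 30 = y + t * 30 / m k := by
      intro t; rw [hx]; field_simp; ring
    by_cases h4 : d * 30 / m k ≤ 1/550
    · have hd' : 0 < d * 30 / m k := by positivity
      refine ih _ hd' h4 ?_ ?_ ?_
      · intro i hi hi' h
        refine hb i hi hi' (S.right k _ _ h ?_)
        rw [hx]; field_simp; ring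
      · intro h
        rw [← key] at h ⊢
        have h' : 1 < (1 - (x + d)) / m k := by linarith
        rw [lt_div_iff₀ hk] at h'
        exact right_inv k (hz1 (by linarith)) (by linarith) (by linarith)
      · intro h
        have e : y + 2 * (d * 30 / m k) = y + (2 * d) * 30 / m k := by ring
        rw [e, ← key] at h ⊢
        have h' : 1 < (1 - (x + 2 * d)) / m k := by linarith
        rw [lt_div_iff₀ hk] at h'
        exact right_inv k (hz2 (by linarith)) (by linarith) (by linarith)
    · rw [not_le, lt_div_iff₀ hk] at h4
      obtain ⟨j, h5, h6⟩ := scale hd (by linarith)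
      have hj := m_pos j
      by_cases hjk : j < k
      · have := m_le_of_lt hjk
        obtain ⟨i, hi, hi', h5, h6⟩ := hit (x := x) (u := 1 - m j * (1 + 209/7200))
          (v := 1 - m j * (1 + 31/7200)) hd (by linarith) (by linarith) (by linarith)
        exact hb i hi hi' (right_core j h5 h6)
      · have hmk : m j ≤ m k := by
          rcases (not_lt.mp hjk).lt_or_eq with h | h
          · have := m_le_of_lt h; linarith
          · rw [h]
        rcases k with _ | k
        · rw [m_zero] at *
          obtain ⟨i, hi, hi', h5, h6⟩ := hit (x := x) (u := 209/240 - 2 * d)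
            (v := 209/240) hd (by linarith) (by linarith) (by linarith)
          exact hb i hi hi' (S.core _ (by linarith) h6)
        · have e := m_succ k
          obtain ⟨i, hi, hi', h5, h6⟩ := hit (x := x) (u := 1 - m k * (1 + 209/7200))
            (v := 1 - m k * (1 + 31/7200)) hd (by linarith) (by linarith) (by linarith)
          exact hb i hi hi' (right_core k h5 h6)

/-- The red set on the circle `ℝ/ℤ`. -/
def Rd (t : ℝ) : Prop := S (4/3 * Int.fract t)

lemma fract_of {t u : ℝ} (h0 : 0 ≤ Int.fract t + u) (h1 : Int.fract t + u < 1) :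
    Int.fract (t + u) = Int.fract t + u := by
  rw [Int.fract_eq_iff]
  exact ⟨h0, h1, ⌊t⌋, by rw [Int.fract]; ring⟩

lemma Rd_symm {t : ℝ} (h : Rd t) : Rd (3/4 - t) := by
  unfold Rd at *
  obtain ⟨h0, h1⟩ := S_pos h
  have : Int.fract (3/4 - t) = 3/4 - Int.fract t := by
    rw [Int.fract_eq_iff]
    exact ⟨by linarith, by linarith, -⌊t⌋, by rw [Int.fract]; push_cast; ring⟩
  rw [this]
  have := S_symm h
  convert this using 1
  ring

lemma circle {t θ : ℝ} (h0 : 0 < θ) (h1 : θ ≤ 1/2) (ha : Rd t) (hb : Rd (t + θ))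
    (hc : Rd (t + 2 * θ)) (hbl : ∀ i : ℕ, 1 ≤ i → i ≤ 30000 → ¬ Rd (t - i * θ)) : False := by
  have hf := Int.fract_nonneg t
  by_cases h : 4/3 * θ ≤ 1/550
  · refine main ha (4/3 * θ) (by linarith) h ?_ ?_ ?_
    · intro i hi hi' hS
      apply hbl i hi hi'
      obtain ⟨h2, h3⟩ := S_pos hS
      unfold Rd
      have := fract_of (t := t) (u := -(i * θ)) (by linarith) (by linarith)
      rw [sub_eq_add_neg, this]
      convert hS using 1
      ring
    · intro h2
      unfold Rd at hb
      rw [fract_of (by linarith) (by linarith)] at hb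
      convert hb using 1
      ring
    · intro h2
      unfold Rd at hc
      rw [fract_of (by linarith) (by linarith)] at hc
      convert hc using 1
      ring
  · have hf1 := Int.fract_lt_one t
    obtain ⟨i, hi, hi', h5, h6⟩ := hit (x := Int.fract t) (u := 31/320 - 1) (v := 209/320 - 1)
      h0 (by linarith) (by linarith) (by linarith)
    apply hbl i hi hi'
    unfold Rd
    have : Int.fract (t - i * θ) = Int.fract t - i * θ + 1 := by
      rw [Int.fract_eq_iff]
      exact ⟨by linarith, by linarith, ⌊t⌋ - 1, by rw [Int.fract]; push_cast; ring⟩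
    rw [this]
    exact S.core _ (by linarith) (by linarith)

/-- Two-sided version of `circle`. -/
lemma circle' {t θ : ℝ} (h0 : θ ≠ 0) (h1 : |θ| ≤ 1/2)
    (ha : ∀ i : ℕ, i < 3 → Rd (t + i * θ))
    (hb : ∀ i : ℕ, 3 ≤ i → i < 3 + 30000 → ¬ Rd (t + i * θ)) : False := by
  have a0 := ha 0 (by norm_num)
  have a1 := ha 1 (by norm_num)
  have a2 := ha 2 (by norm_num)
  push_cast at a0 a1 a2
  obtain ⟨hl, hr⟩ := abs_le.mp h1
  rcases lt_or_gt_of_ne h0 with h | h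
  · refine circle (t := t + 2 * θ) (θ := -θ) (by linarith) (by linarith) a2 ?_ ?_ ?_
    · convert a1 using 1; ring
    · convert a0 using 1; ring
    · intro i hi hi' hR
      refine hb (i + 2) (by omega) (by omega) ?_
      convert hR using 1; push_cast; ring
  · refine circle (t := 3/4 - (t + 2 * θ)) (θ := θ) (by linarith) (by linarith) (Rd_symm a2) ?_ ?_ ?_
    · convert Rd_symm a1 using 1; ring
    · convert Rd_symm a0 using 1; ring
    · intro i hi hi' hR
      refine hb (i + 2) (by omega) (by omega) ?_
      convert Rd_symm hR using 1; push_cast; ring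

/-- The red set in `ZMod p`. -/
def A (p : ℕ) : Set (ZMod p) := {x | Rd ((x.val : ℝ) / p)}

lemma Rd_add_int {t : ℝ} (n : ℤ) : Rd (t + n) ↔ Rd t := by
  unfold Rd; rw [Int.fract_add_intCast]

lemma mem_A {p : ℕ} [NeZero p] (n : ℤ) : ((n : ZMod p) ∈ A p) ↔ Rd ((n : ℝ) / p) := by
  have hp : (p : ℝ) ≠ 0 := by exact_mod_cast NeZero.ne p
  show Rd _ ↔ _
  have h : (((n : ZMod p).val : ℤ) : ℝ) = ((n % (p : ℤ) : ℤ) : ℝ) := by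
    rw [ZMod.val_intCast]
  have h2 : (n : ℝ) = ((n % (p : ℤ) : ℤ) : ℝ) + p * ((n / (p : ℤ) : ℤ) : ℝ) := by
    exact_mod_cast (Int.emod_add_mul_ediv n p).symm
  rw [h2, add_div, mul_div_cancel_left₀ _ hp, Rd_add_int, ← h, Int.cast_natCast]

lemma noAP {p : ℕ} [NeZero p] : ¬ ∃ x d : ZMod p, d ≠ 0 ∧
    (∀ i : ℕ, i < 3 → x + (i : ZMod p) * d ∈ A p) ∧
    (∀ i : ℕ, 3 ≤ i → i < 3 + 30000 → x + (i : ZMod p) * d ∉ A p) := by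
  rintro ⟨x, d, hd, ha, hb⟩
  have hp : (0 : ℝ) < p := by exact_mod_cast Nat.pos_of_ne_zero (NeZero.ne p)
  have key : ∀ i : ℕ, x + (i : ZMod p) * d ∈ A p ↔
      Rd ((x.val : ℝ) / p + i * ((d.valMinAbs : ℝ) / p)) := by
    intro i
    have e : x + (i : ZMod p) * d = (((x.val : ℤ) + i * d.valMinAbs : ℤ) : ZMod p) := by
      push_cast
      rw [ZMod.natCast_zmod_val]
    rw [e, mem_A]
    push_cast
    rw [add_div, mul_div_assoc]
  refine circle' (t := (x.val : ℝ) / p) (θ := (d.valMinAbs : ℝ) / p) ?_ ?_ ?_ ?_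
  · have : d.valMinAbs ≠ 0 := by rwa [Ne, ZMod.valMinAbs_eq_zero]
    have : (d.valMinAbs : ℝ) ≠ 0 := by exact_mod_cast this
    exact div_ne_zero this hp.ne'
  · obtain ⟨h1, h2⟩ := ZMod.valMinAbs_mem_Ioc d
    have h1' : -(p : ℝ) < d.valMinAbs * 2 := by exact_mod_cast h1
    have h2' : (d.valMinAbs : ℝ) * 2 ≤ p := by exact_mod_cast h2
    rw [abs_le]
    constructor
    · rw [le_div_iff₀ hp]; linarith
    · rw [div_le_iff₀ hp]; linarith
  · intro i hi; exact (key i).mp (ha i hi)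
  · intro i hi hi' h; exact hb i hi hi' ((key i).mpr h)

lemma card_ge {p : ℕ} [NeZero p] (T : Set (ZMod p)) (a b : ℕ) (hb : b ≤ p)
    (h : ∀ n : ℕ, a ≤ n → n < b → (n : ZMod p) ∈ T) : b - a ≤ Nat.card T := by
  classical
  have h1 : ((Finset.Ico a b).image (fun n : ℕ => (n : ZMod p))).card = b - a := by
    rw [Finset.card_image_of_injOn, Nat.card_Ico]
    intro u hu v hv huv
    simp only [Finset.coe_Ico, Set.mem_Ico] at hu hv
    have := congrArg ZMod.val huv
    simpa [ZMod.val_cast_of_lt (show u < p by omega), ZMod.val_cast_of_lt (show v < p by omega)]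
      using this
  rw [← h1, ← Set.ncard_coe_finset, Nat.card_coe_set_eq]
  apply Set.ncard_le_ncard _ (Set.toFinite T)
  intro z hz
  simp only [Finset.coe_image, Finset.coe_Ico, Set.mem_image, Set.mem_Ico] at hz
  obtain ⟨n, ⟨h2, h3⟩, rfl⟩ := hz
  exact h n h2 h3

lemma first : ∀ δ : ℝ, δ < 2 / 95 → ∀ p : ℕ, p.Prime → 100 ≤ p →
    δ * p ≤ Nat.card ↥(A p) ∧ δ * p ≤ Nat.card ↥((A p)ᶜ) := by
  intro δ hδ p hp h100
  haveI : NeZero p := ⟨hp.ne_zero⟩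
  have hpos : (0 : ℝ) < p := by exact_mod_cast hp.pos
  have hR : (100 : ℝ) ≤ p := by exact_mod_cast h100
  have hlt : δ * p ≤ 2/95 * p := by nlinarith
  have fin : ∀ c : ℕ, p ≤ 20 * c → δ * p ≤ c := by
    intro c hc
    have : (p : ℝ) ≤ 20 * c := by exact_mod_cast hc
    linarith
  have fr : ∀ n : ℕ, n < p → Int.fract ((n : ℝ)/p) = (n : ℝ)/p := by
    intro n hn
    rw [Int.fract_eq_self]
    exact ⟨by positivity, by rw [div_lt_one hpos]; exact_mod_cast hn⟩
  constructor
  · apply fin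
    have := card_ge (A p) (p/4+1) (p/2) (by omega) ?_
    · omega
    · intro n h1 h2
      show Rd _
      rw [ZMod.val_cast_of_lt (by omega)]
      unfold Rd
      rw [fr n (by omega)]
      have h1' : (p : ℝ) ≤ 4 * n := by exact_mod_cast (show p ≤ 4 * n by omega)
      have h2' : 2 * (n : ℝ) ≤ p := by exact_mod_cast (show 2 * n ≤ p by omega)
      have h3 : 1/4 ≤ (n : ℝ)/p := by rw [le_div_iff₀ hpos]; linarith
      have h4 : (n : ℝ)/p ≤ 1/2 := by rw [div_le_iff₀ hpos]; linarith
      exact S.core _ (by linarith) (by linarith)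
  · apply fin
    have := card_ge (A p)ᶜ (3*p/4+1) p le_rfl ?_
    · omega
    · intro n h1 h2 hmem
      change Rd _ at hmem
      rw [ZMod.val_cast_of_lt (by omega)] at hmem
      unfold Rd at hmem
      rw [fr n (by omega)] at hmem
      have h1' : 3 * (p : ℝ) ≤ 4 * n := by exact_mod_cast (show 3 * p ≤ 4 * n by omega)
      have h3 : 3/4 ≤ (n : ℝ)/p := by rw [le_div_iff₀ hpos]; linarith
      have := (S_pos hmem).2
      linarith

end FP

/-- For every real δ < 2/95 there exists p₁ such that for every prime
p ≥ p₁ there is a red–blue colouring of ℤ/pℤ in which each colour class has at least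
δ·p elements and which contains no (3,30000)-AP. In particular (3,30000) is not
findable. -/
theorem statement4 :
    (∀ δ : ℝ, δ < 2 / 95 → ∃ p₁ : ℕ, ∀ p : ℕ, p.Prime → p₁ ≤ p →
      ∃ A : Set (ZMod p),
        δ * p ≤ Nat.card ↥A ∧ δ * p ≤ Nat.card ↥(Aᶜ) ∧ ¬ HasAP A 3 30000) ∧
    ¬ Findable 3 30000 := by
  have H : ∀ δ : ℝ, δ < 2 / 95 → ∃ p₁ : ℕ, ∀ p : ℕ, p.Prime → p₁ ≤ p →
      ∃ A : Set (ZMod p),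
        δ * p ≤ Nat.card ↥A ∧ δ * p ≤ Nat.card ↥(Aᶜ) ∧ ¬ HasAP A 3 30000 := by
    intro δ hδ
    refine ⟨100, fun p hp h100 => ⟨FP.A p, ?_⟩⟩
    haveI : NeZero p := ⟨hp.ne_zero⟩
    obtain ⟨h1, h2⟩ := FP.first δ hδ p hp h100
    exact ⟨h1, h2, FP.noAP⟩
  refine ⟨H, fun hF => ?_⟩
  obtain ⟨p₀, h0⟩ := hF (1/95) (by norm_num)
  obtain ⟨p₁, h1⟩ := H (1/95) (by norm_num)
  obtain ⟨p, hp, hprime⟩ := Nat.exists_infinite_primes (max p₀ p₁)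
  obtain ⟨A, ha, hb, hn⟩ := h1 p hprime (le_trans (le_max_right _ _) hp)
  exact hn (h0 p hprime (le_trans (le_max_left _ _) hp) A ha hb)
end
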